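/- There exists β₀ > 0 such that for all β < β₀ the following holds: for every n ≥ 1 and m ≥ 0 there is a constant K depending only on n and m such that for every function f on Σ_N^n, |ν(f) − Σ_{j=0}^m ν₀^{(j)}(f)/j!| ≤ (K/N^{(m+1)/2})·ν(f²)^{1/2}, where ν₀^{(j)}(f) denotes the j-th derivative of t ↦ ν_t(f) evaluated at t = 0. -/

import Mathlib

open MeasureTheory ProbabilityTheory Finset

noncomputable section

/-- A spin configuration on `N` sites. -/
abbrev Cfg (N : ℕ) := Fin N → Bool

/-- The spin value `±1` of a Boolean. -/
def spin (b : Bool) : ℝ := if b then 1 else -1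

/-- Minus the SK Hamiltonian. -/
def negH (N : ℕ) (β h : ℝ) (g : Fin N → Fin N → ℝ) (σ : Cfg N) : ℝ :=
  (β / Real.sqrt N) *
      ∑ i : Fin N, ∑ j : Fin N, (if i < j then g i j * spin (σ i) * spin (σ j) else 0) +
    h * ∑ i : Fin N, spin (σ i)

/-- Gibbs average `⟨f⟩` of a function of `ι`-indexed replicas. -/
def gibbs (N : ℕ) (β h : ℝ) (g : Fin N → Fin N → ℝ) {ι : Type} [DecidableEq ι] [Fintype ι]
    (f : (ι → Cfg N) → ℝ) : ℝ :=
  (∑ σs : ι → Cfg N, f σs * ∏ l, Real.exp (negH N β h g (σs l))) /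
    (∑ σ : Cfg N, Real.exp (negH N β h g σ)) ^ (Fintype.card ι)

/-- The law of the disorder: i.i.d. standard Gaussians. -/
def gaussN (N : ℕ) : Measure (Fin N → Fin N → ℝ) :=
  Measure.pi fun _ => Measure.pi fun _ => gaussianReal 0 1

/-- `ν(f) = E⟨f⟩`. -/
def nu (N : ℕ) (β h : ℝ) {ι : Type} [DecidableEq ι] [Fintype ι]
    (f : (ι → Cfg N) → ℝ) : ℝ :=
  ∫ g, gibbs N β h g f ∂ gaussN N

/-- `S_l = Σ_i t_i (σ_i^{1(l)} - σ_i^{2(l)})`, replica pairs indexed by `Fin m × Fin 2`. -/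
def Sbar (N m : ℕ) (t : Fin N → ℝ) (σs : Fin m × Fin 2 → Cfg N) (l : Fin m) : ℝ :=
  ∑ i, t i * (spin (σs (l, 0) i) - spin (σs (l, 1) i))

/-- `a(k)`: the `k`-th moment of a standard Gaussian. -/
def gaussMoment (k : ℕ) : ℝ := ∫ x, x ^ k ∂ (gaussianReal 0 1 : Measure ℝ)

/-- The overlap `R_{l,l'}` of two configurations. -/
def overlap (N : ℕ) (σ τ : Cfg N) : ℝ := (∑ i, spin (σ i) * spin (τ i)) / N

/-- Minus the one-coordinate interpolating Hamiltonian `-H_{N,t}` (here `N = M+1`, the last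
coordinate `σ_N` plays the special role, `z` is an extra standard Gaussian and `q` is the
solution of `q = E tanh²(βz√q + h)`). -/
def negHt (M : ℕ) (β h q s : ℝ) (g : Fin (M + 1) → Fin (M + 1) → ℝ) (z : ℝ)
    (σ : Cfg (M + 1)) : ℝ :=
  (β / Real.sqrt (M + 1)) *
      ∑ i : Fin M, ∑ j : Fin M,
        (if i < j then
          g i.castSucc j.castSucc * spin (σ i.castSucc) * spin (σ j.castSucc) else 0) +
    Real.sqrt s * (spin (σ (Fin.last M)) * (β / Real.sqrt (M + 1)) *
      ∑ i : Fin M, g i.castSucc (Fin.last M) * spin (σ i.castSucc)) +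
    β * Real.sqrt (1 - s) * z * Real.sqrt q * spin (σ (Fin.last M)) +
    h * ∑ i, spin (σ i)

/-- Gibbs average `⟨f⟩_t` for the one-coordinate interpolating Hamiltonian. -/
def gibbsT (M : ℕ) (β h q s : ℝ) (g : Fin (M + 1) → Fin (M + 1) → ℝ) (z : ℝ)
    {ι : Type} [DecidableEq ι] [Fintype ι] (f : (ι → Cfg (M + 1)) → ℝ) : ℝ :=
  (∑ σs : ι → Cfg (M + 1), f σs * ∏ l, Real.exp (negHt M β h q s g z (σs l))) /
    (∑ σ : Cfg (M + 1), Real.exp (negHt M β h q s g z σ)) ^ (Fintype.card ι)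

/-- `ν_t(f) = E⟨f⟩_t` for the one-coordinate interpolation. -/
def nuT (M : ℕ) (β h q s : ℝ) {ι : Type} [DecidableEq ι] [Fintype ι]
    (f : (ι → Cfg (M + 1)) → ℝ) : ℝ :=
  ∫ gz : (Fin (M + 1) → Fin (M + 1) → ℝ) × ℝ, gibbsT M β h q s gz.1 gz.2 f
    ∂ (gaussN (M + 1)).prod (gaussianReal 0 1)

/-- The truncated overlap `R⁻_{l,l'} = N^{-1} Σ_{i ≤ N-1} σ_i^l σ_i^{l'}` (here `N = M+1`). -/
def overlapMinus (M : ℕ) (σ τ : Cfg (M + 1)) : ℝ :=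
  (∑ i : Fin M, spin (σ i.castSucc) * spin (τ i.castSucc)) / (M + 1)

/-! ### Replica averages of a finite Gibbs measure -/

/-- The Gibbs probability of a configuration, for the Boltzmann weight `exp (H σ)`. -/
def gibbsProb {C : Type*} [Fintype C] (H : C → ℝ) (σ : C) : ℝ :=
  Real.exp (H σ) / ∑ τ, Real.exp (H τ)

/-- The average of a function of `n` independent replicas of a Gibbs measure. -/
def replicaAvg {C : Type*} [Fintype C] {n : ℕ} (H : C → ℝ) (f : (Fin n → C) → ℝ) : ℝ :=
  ∑ σs, f σs * ∏ l, gibbsProb H (σs l)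

/-- The function of `n + 1` replicas whose average is the derivative of the average of `f` when the
Hamiltonian moves in the direction `v`; replica `0` is the new one. -/
def replicaDeriv {C : Type*} {n : ℕ} (v : C → ℝ) (f : (Fin n → C) → ℝ) (σs : Fin (n + 1) → C) :
    ℝ :=
  f (fun l => σs l.succ) * (∑ l : Fin n, v (σs l.succ) - n * v (σs 0))

lemma abs_replicaDeriv_le {C : Type*} {n : ℕ} (v : C → ℝ) (f : (Fin n → C) → ℝ) {B : ℝ}
    (hv : ∀ σ, |v σ| ≤ B) (σs : Fin (n + 1) → C) :
    |replicaDeriv v f σs| ≤ |f (fun l => σs l.succ)| * (2 * n * B) := by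
  unfold replicaDeriv
  rw [abs_mul]
  refine mul_le_mul_of_nonneg_left ?_ (abs_nonneg _)
  have h1 : |∑ l : Fin n, v (σs l.succ)| ≤ n * B := by
    refine (Finset.abs_sum_le_sum_abs _ _).trans ?_
    refine (Finset.sum_le_sum fun l _ => hv _).trans ?_
    simp
  have h2 : |(n : ℝ) * v (σs 0)| ≤ n * B := by
    rw [abs_mul, Nat.abs_cast]
    exact mul_le_mul_of_nonneg_left (hv _) (Nat.cast_nonneg n)
  rw [abs_le] at h1 h2 ⊢
  constructor <;> linarith

section replicaAvg

variable {C : Type*} [Fintype C]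

lemma partition_pos [Nonempty C] (H : C → ℝ) : 0 < ∑ τ, Real.exp (H τ) :=
  Finset.sum_pos (fun _ _ => Real.exp_pos _) Finset.univ_nonempty

lemma gibbsProb_nonneg (H : C → ℝ) (σ : C) : 0 ≤ gibbsProb H σ := by
  unfold gibbsProb; positivity

lemma sum_gibbsProb [Nonempty C] (H : C → ℝ) : ∑ σ, gibbsProb H σ = 1 := by
  unfold gibbsProb
  rw [← Finset.sum_div, div_self (partition_pos H).ne']

lemma gibbsProb_le_one [Nonempty C] (H : C → ℝ) (σ : C) : gibbsProb H σ ≤ 1 := by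
  rw [← sum_gibbsProb H]
  exact Finset.single_le_sum (fun τ _ => gibbsProb_nonneg H τ) (Finset.mem_univ σ)

lemma prod_gibbsProb_nonneg {n : ℕ} (H : C → ℝ) (σs : Fin n → C) :
    0 ≤ ∏ l, gibbsProb H (σs l) :=
  Finset.prod_nonneg fun _ _ => gibbsProb_nonneg H _

lemma prod_gibbsProb_le_one [Nonempty C] {n : ℕ} (H : C → ℝ) (σs : Fin n → C) :
    ∏ l, gibbsProb H (σs l) ≤ 1 :=
  Finset.prod_le_one (fun _ _ => gibbsProb_nonneg H _) fun _ _ => gibbsProb_le_one H _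

lemma abs_replicaAvg_le [Nonempty C] {n : ℕ} (H : C → ℝ) (f : (Fin n → C) → ℝ) :
    |replicaAvg H f| ≤ ∑ σs, |f σs| := by
  refine (Finset.abs_sum_le_sum_abs _ _).trans (Finset.sum_le_sum fun σs _ => ?_)
  rw [abs_mul, abs_of_nonneg (prod_gibbsProb_nonneg H σs)]
  exact mul_le_of_le_one_right (abs_nonneg _) (prod_gibbsProb_le_one H σs)

lemma replicaAvg_mono {n : ℕ} (H : C → ℝ) {f g : (Fin n → C) → ℝ} (hfg : ∀ σs, f σs ≤ g σs) :
    replicaAvg H f ≤ replicaAvg H g :=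
  Finset.sum_le_sum fun σs _ =>
    mul_le_mul_of_nonneg_right (hfg σs) (prod_gibbsProb_nonneg H σs)

lemma sum_prod_mul_eq {n : ℕ} (w : Fin n → C → ℝ) :
    ∑ σs : Fin n → C, ∏ l, w l (σs l) = ∏ l, ∑ σ, w l σ := by
  classical
  rw [Finset.prod_univ_sum, Fintype.piFinset_univ]

lemma replicaAvg_comp_injective [Nonempty C] {k n : ℕ} (H : C → ℝ) (f : (Fin k → C) → ℝ)
    {e : Fin k → Fin n} (he : Function.Injective e) :
    replicaAvg H (fun σs => f (fun j => σs (e j))) = replicaAvg H f := by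
  classical
  have h1 : ∀ σs : Fin n → C, f (fun j => σs (e j)) =
      ∑ τ : Fin k → C, f τ * ∏ j, (if σs (e j) = τ j then (1 : ℝ) else 0) := by
    intro σs
    rw [Finset.sum_eq_single (fun j => σs (e j))]
    · simp
    · intro τ _ hτ
      obtain ⟨j, hj⟩ : ∃ j, τ j ≠ σs (e j) := by
        by_contra hcon
        push Not at hcon
        exact hτ (funext hcon)
      rw [Finset.prod_eq_zero (Finset.mem_univ j), mul_zero]
      rw [if_neg (Ne.symm hj)]
    · simp
  unfold replicaAvg
  simp_rw [h1, Finset.sum_mul]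
  rw [Finset.sum_comm]
  refine Finset.sum_congr rfl fun τ _ => ?_
  simp_rw [mul_assoc]
  rw [← Finset.mul_sum]
  congr 1
  set w : Fin n → C → ℝ :=
    Function.extend e (fun j σ => if σ = τ j then (1 : ℝ) else 0) (fun _ _ => 1) with hw
  have h2 : ∀ σs : Fin n → C, ∏ j, (if σs (e j) = τ j then (1 : ℝ) else 0) =
      ∏ l, w l (σs l) := by
    intro σs
    refine Fintype.prod_of_injective e he _ _ (fun l hl => ?_) (fun j => ?_)
    · rw [hw, Function.extend_apply' _ _ _ (by simpa using hl)]
    · rw [hw, he.extend_apply]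
  simp_rw [h2, ← Finset.prod_mul_distrib]
  rw [sum_prod_mul_eq (fun l σ => w l σ * gibbsProb H σ)]
  symm
  refine Fintype.prod_of_injective e he _ _ (fun l hl => ?_) (fun j => ?_)
  · rw [hw, Function.extend_apply' _ _ _ (by simpa using hl)]
    simpa using sum_gibbsProb H
  · rw [hw, he.extend_apply]
    simp

lemma hasDerivAt_gibbsProb [Nonempty C] {H : ℝ → C → ℝ} {v : C → ℝ} {s : ℝ}
    (hH : ∀ σ, HasDerivAt (fun r => H r σ) (v σ) s) (σ : C) :
    HasDerivAt (fun r => gibbsProb (H r) σ)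
      (gibbsProb (H s) σ * (v σ - ∑ τ, gibbsProb (H s) τ * v τ)) s := by
  have hZ := HasDerivAt.fun_sum (u := Finset.univ) fun τ _ => (hH τ).exp
  have hd := (hH σ).exp.fun_div hZ (partition_pos (H s)).ne'
  refine hd.congr_deriv ?_
  have hZ0 := (partition_pos (H s)).ne'
  unfold gibbsProb
  simp_rw [div_mul_eq_mul_div]
  rw [← Finset.sum_div]
  field_simp

lemma replicaAvg_replicaDeriv [Nonempty C] {n : ℕ} (H : C → ℝ) (v : C → ℝ)
    (f : (Fin n → C) → ℝ) :
    replicaAvg H (replicaDeriv v f) =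
      ∑ σs, f σs * ((∏ l, gibbsProb H (σs l)) *
        (∑ l, v (σs l) - n * ∑ τ, gibbsProb H τ * v τ)) := by
  unfold replicaAvg replicaDeriv
  rw [← (Fin.consEquiv fun _ => C).sum_comp, Fintype.sum_prod_type, Finset.sum_comm]
  refine Finset.sum_congr rfl fun σs _ => ?_
  simp only [Fin.consEquiv_apply, Fin.cons_succ, Fin.cons_zero, Fin.prod_univ_succ]
  have h1 := sum_gibbsProb H
  calc _ = ∑ τ, (f σs * ((∏ l, gibbsProb H (σs l)) * (∑ l, v (σs l))) * gibbsProb H τ -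
        f σs * ((∏ l, gibbsProb H (σs l)) * n) * (gibbsProb H τ * v τ)) :=
        Finset.sum_congr rfl fun τ _ => by ring
    _ = _ := by
        rw [Finset.sum_sub_distrib, ← Finset.mul_sum, ← Finset.mul_sum, h1]; ring

lemma hasDerivAt_replicaAvg [Nonempty C] {n : ℕ} {H : ℝ → C → ℝ} {v : C → ℝ} {s : ℝ}
    (hH : ∀ σ, HasDerivAt (fun r => H r σ) (v σ) s) (f : (Fin n → C) → ℝ) :
    HasDerivAt (fun r => replicaAvg (H r) f) (replicaAvg (H s) (replicaDeriv v f)) s := by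
  rw [replicaAvg_replicaDeriv]
  refine HasDerivAt.fun_sum fun σs _ => ?_
  refine HasDerivAt.const_mul (f σs) ?_
  have hp := HasDerivAt.fun_finsetProd (u := Finset.univ)
    fun l _ => hasDerivAt_gibbsProb hH (σs l)
  refine hp.congr_deriv ?_
  calc _ = ∑ l, (∏ j, gibbsProb (H s) (σs j)) *
        (v (σs l) - ∑ τ, gibbsProb (H s) τ * v τ) := by
        refine Finset.sum_congr rfl fun l _ => ?_
        rw [← Finset.prod_erase_mul _ _ (Finset.mem_univ l), smul_eq_mul]; ring
    _ = _ := by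
        rw [← Finset.mul_sum, Finset.sum_sub_distrib]; simp

lemma abs_replicaAvg_le_replicaAvg_abs {n : ℕ} (H : C → ℝ) (f : (Fin n → C) → ℝ) :
    |replicaAvg H f| ≤ replicaAvg H fun σs => |f σs| := by
  refine (Finset.abs_sum_le_sum_abs _ _).trans (Finset.sum_le_sum fun σs _ => ?_)
  rw [abs_mul, abs_of_nonneg (prod_gibbsProb_nonneg H σs)]

lemma abs_replicaAvg_replicaDeriv_le [Nonempty C] {n : ℕ} (H : C → ℝ) (v : C → ℝ)
    (f : (Fin n → C) → ℝ) {B : ℝ} (hv : ∀ σ, |v σ| ≤ B) :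
    |replicaAvg H (replicaDeriv v f)| ≤ (∑ σs, |f σs|) * (2 * n * B) := by
  have hB : 0 ≤ B := (abs_nonneg _).trans (hv (Classical.arbitrary C))
  calc |replicaAvg H (replicaDeriv v f)|
      ≤ replicaAvg H (fun σs => |replicaDeriv v f σs|) := abs_replicaAvg_le_replicaAvg_abs _ _
    _ ≤ replicaAvg H (fun σs => |f (fun l => σs l.succ)| * (2 * n * B)) :=
        replicaAvg_mono H (abs_replicaDeriv_le v f hv)
    _ = replicaAvg H (fun σs => |f σs| * (2 * n * B)) :=
        replicaAvg_comp_injective H (fun σs => |f σs| * (2 * n * B)) (Fin.succ_injective n)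
    _ ≤ ∑ σs, |(|f σs| * (2 * n * B))| := (le_abs_self _).trans (abs_replicaAvg_le _ _)
    _ = _ := by
        rw [Finset.sum_mul]
        refine Finset.sum_congr rfl fun σs _ => ?_
        rw [abs_mul, abs_abs, abs_of_nonneg (by positivity : (0 : ℝ) ≤ 2 * n * B)]

lemma continuous_replicaAvg [Nonempty C] {X : Type*} [TopologicalSpace X] {n : ℕ} {H : X → C → ℝ}
    (hH : ∀ σ, Continuous fun x => H x σ) (f : (Fin n → C) → ℝ) :
    Continuous fun x => replicaAvg (H x) f := by
  unfold replicaAvg gibbsProb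
  refine continuous_finsetSum _ fun σs _ => continuous_const.mul <|
    continuous_finsetProd _ fun l _ => Continuous.div (hH _).rexp
      (continuous_finsetSum _ fun τ _ => (hH τ).rexp) fun x => (partition_pos _).ne'

end replicaAvg

/-! ### Gaussian integration by parts and differentiation of Gaussian averages -/

lemma hasDerivAt_gaussianPDFReal (x : ℝ) :
    HasDerivAt (gaussianPDFReal 0 1) (-(x * gaussianPDFReal 0 1 x)) x := by
  have h1 : HasDerivAt (fun y : ℝ => -(y - 0) ^ 2 / (2 * ((1 : NNReal) : ℝ))) (-x) x := by
    have h := ((hasDerivAt_id x).pow 2).neg.div_const 2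
    have h0 : -(2 * x) / 2 = -x := by ring
    simpa [h0] using h
  have h2 := h1.exp.const_mul (Real.sqrt (2 * Real.pi * ((1 : NNReal) : ℝ)))⁻¹
  rw [gaussianPDFReal_def]
  refine h2.congr_deriv ?_
  ring

lemma integrable_mul_gaussianPDFReal : Integrable fun x : ℝ => x * gaussianPDFReal 0 1 x := by
  have h := (integrable_mul_exp_neg_mul_sq (b := 1 / 2) (by norm_num)).const_mul
    (Real.sqrt (2 * Real.pi * ((1 : NNReal) : ℝ)))⁻¹
  refine h.congr (Filter.Eventually.of_forall fun x => ?_)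
  simp only [gaussianPDFReal_def, sub_zero, NNReal.coe_one]
  rw [show -x ^ 2 / (2 * 1) = -(1 / 2) * x ^ 2 by ring]
  ring

/-- Gaussian integration by parts for a bounded function with bounded derivative. -/
lemma integral_mul_gaussianReal {φ φ' : ℝ → ℝ} (hφ : ∀ x, HasDerivAt φ (φ' x) x) {K K' : ℝ}
    (hK : ∀ x, |φ x| ≤ K) (hK' : ∀ x, |φ' x| ≤ K') :
    ∫ x, x * φ x ∂(gaussianReal 0 1) = ∫ x, φ' x ∂(gaussianReal 0 1) := by
  have hm : Measurable φ := (continuous_iff_continuousAt.2 fun x => (hφ x).continuousAt).measurable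
  have hm' : Measurable φ' := by
    rw [show φ' = deriv φ from funext fun x => (hφ x).deriv.symm]
    exact measurable_deriv φ
  have hi := (integrable_gaussianPDFReal 0 1).bdd_mul hm.aestronglyMeasurable
    (Filter.Eventually.of_forall hK)
  have hi' := (integrable_gaussianPDFReal 0 1).bdd_mul hm'.aestronglyMeasurable
    (Filter.Eventually.of_forall hK')
  have hix := integrable_mul_gaussianPDFReal.bdd_mul hm.aestronglyMeasurable
    (Filter.Eventually.of_forall hK)
  have h0 := integral_eq_zero_of_hasDerivAt_of_integrable
    (fun x => (hφ x).mul (hasDerivAt_gaussianPDFReal x))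
    (hi'.add (by simpa using hix.neg)) hi
  rw [integral_gaussianReal_eq_integral_smul one_ne_zero,
    integral_gaussianReal_eq_integral_smul one_ne_zero, ← sub_eq_zero, ← integral_sub]
  · rw [← neg_eq_zero, ← integral_neg]
    refine Eq.trans ?_ h0
    refine integral_congr_ae (Filter.Eventually.of_forall fun x => ?_)
    simp only [smul_eq_mul]
    ring
  · refine hix.congr (Filter.Eventually.of_forall fun x => ?_)
    simp only [smul_eq_mul]
    ring
  · refine hi'.congr (Filter.Eventually.of_forall fun x => ?_)
    simp only [smul_eq_mul]
    ring

/-- The law of a family of i.i.d. standard Gaussians. -/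
def gaussPi (A : Type*) [Fintype A] : Measure (A → ℝ) :=
  Measure.pi fun _ => gaussianReal 0 1

instance (A : Type*) [Fintype A] : IsProbabilityMeasure (gaussPi A) := by
  unfold gaussPi; infer_instance

/-- The Hamiltonian `u + Σ_a c_a x_a v_a`. -/
def linHam {A C : Type*} [Fintype A] (u : C → ℝ) (v : A → C → ℝ) (c x : A → ℝ) (σ : C) : ℝ :=
  u σ + ∑ a, c a * x a * v a σ

/-- The average of `f` under replicas of the Gibbs measure with Gaussian Hamiltonian
`u + Σ_a c_a x_a v_a`, averaged over the Gaussians `x_a`. -/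
def gaussAvg {A C : Type*} [Fintype A] [Fintype C] {n : ℕ} (u : C → ℝ) (v : A → C → ℝ) (c : A → ℝ)
    (f : (Fin n → C) → ℝ) : ℝ :=
  ∫ x, replicaAvg (linHam u v c x) f ∂(gaussPi A)

lemma continuous_linHam {A C : Type*} [Fintype A] (u : C → ℝ) (v : A → C → ℝ) (c : A → ℝ) (σ : C) :
    Continuous fun x => linHam u v c x σ := by
  unfold linHam; fun_prop

lemma replicaAvg_replicaDeriv_sum {A C : Type*} [Fintype A] [Fintype C] {n : ℕ} (H : C → ℝ) (v : A → C → ℝ) (k : A → ℝ)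
    (f : (Fin n → C) → ℝ) :
    replicaAvg H (replicaDeriv (fun σ => ∑ a, k a * v a σ) f) =
      ∑ a, k a * replicaAvg H (replicaDeriv (v a) f) := by
  unfold replicaAvg
  simp_rw [Finset.mul_sum]
  rw [Finset.sum_comm]
  refine Finset.sum_congr rfl fun σs _ => ?_
  unfold replicaDeriv
  have h1 : ∑ l : Fin n, ∑ a, k a * v a (σs l.succ) = ∑ a, k a * ∑ l : Fin n, v a (σs l.succ) := by
    rw [Finset.sum_comm]; simp_rw [Finset.mul_sum]
  rw [h1, Finset.mul_sum, ← Finset.sum_sub_distrib, Finset.mul_sum, Finset.sum_mul]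
  exact Finset.sum_congr rfl fun a _ => by ring

lemma measurePreserving_update_gaussPi {A : Type*} [Fintype A] [DecidableEq A] (a : A) :
    MeasurePreserving (fun p : (A → ℝ) × ℝ => Function.update p.1 a p.2)
      ((gaussPi A).prod (gaussianReal 0 1)) (gaussPi A) := by
  have hm : Measurable fun p : (A → ℝ) × ℝ => Function.update p.1 a p.2 := by
    refine measurable_pi_iff.2 fun b => ?_
    by_cases hb : b = a
    · subst hb; simpa using measurable_snd
    · simp only [Function.update_of_ne hb]; fun_prop
  refine ⟨hm, ?_⟩
  symm
  refine Measure.pi_eq fun s hs => ?_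
  rw [Measure.map_apply hm (MeasurableSet.univ_pi hs)]
  have : (fun p : (A → ℝ) × ℝ => Function.update p.1 a p.2) ⁻¹' (Set.univ.pi s) =
      (Set.univ.pi (Function.update s a Set.univ)) ×ˢ (s a) := by
    ext ⟨x, y⟩
    simp only [Set.mem_preimage, Set.mem_pi, Set.mem_univ, forall_true_left, Set.mem_prod]
    constructor
    · intro h
      refine ⟨fun b => ?_, by simpa using h a⟩
      by_cases hb : b = a
      · subst hb; simp
      · simpa [Function.update_of_ne hb] using h b
    · rintro ⟨h, hy⟩ b
      by_cases hb : b = a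
      · subst hb; simpa using hy
      · simpa [Function.update_of_ne hb] using h b
  rw [this, Measure.prod_prod, gaussPi, Measure.pi_pi, ← Finset.prod_erase_mul _ _ (mem_univ a),
    ← Finset.prod_erase_mul (a := a) univ (fun i => gaussianReal 0 1 (s i)) (mem_univ a)]
  simp only [Function.update_self, measure_univ, mul_one]
  congr 1
  refine Finset.prod_congr rfl fun b hb => ?_
  rw [Function.update_of_ne (Finset.ne_of_mem_erase hb)]

lemma integrable_eval_gaussPi {A : Type*} [Fintype A] (a : A) : Integrable (fun x : A → ℝ => x a) (gaussPi A) := by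
  have h : Integrable (fun y : ℝ => y) (gaussianReal 0 1) :=
    memLp_one_iff_integrable.1 (memLp_id_gaussianReal 1)
  exact (measurePreserving_eval (fun _ : A => gaussianReal 0 1) a).integrable_comp_of_integrable h

section gaussAvg

variable {A C : Type*} [Fintype A] [Fintype C] [Nonempty C]

lemma continuous_replicaAvg_linHam {n : ℕ} (u : C → ℝ) (v : A → C → ℝ) (c : A → ℝ)
    (f : (Fin n → C) → ℝ) : Continuous fun x => replicaAvg (linHam u v c x) f :=
  continuous_replicaAvg (continuous_linHam u v c) f

lemma integrable_replicaAvg_linHam {n : ℕ} (u : C → ℝ) (v : A → C → ℝ) (c : A → ℝ)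
    (f : (Fin n → C) → ℝ) :
    Integrable (fun x => replicaAvg (linHam u v c x) f) (gaussPi A) :=
  Integrable.of_bound (continuous_replicaAvg_linHam u v c f).aestronglyMeasurable
    (∑ σs, |f σs|) (Filter.Eventually.of_forall fun _ => abs_replicaAvg_le _ _)

lemma integrable_mul_replicaAvg_linHam {n : ℕ} (u : C → ℝ) (v : A → C → ℝ) (c : A → ℝ)
    (f : (Fin n → C) → ℝ) (a : A) :
    Integrable (fun x : A → ℝ => x a * replicaAvg (linHam u v c x) f) (gaussPi A) :=
  (integrable_eval_gaussPi a).mul_bdd (continuous_replicaAvg_linHam u v c f).aestronglyMeasurable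
    (Filter.Eventually.of_forall fun _ => abs_replicaAvg_le _ _)

lemma integral_mul_replicaAvg {n : ℕ} (u : C → ℝ) (v : A → C → ℝ) (c : A → ℝ)
    (f : (Fin n → C) → ℝ) (a : A) :
    ∫ x, x a * replicaAvg (linHam u v c x) f ∂(gaussPi A) =
      c a * gaussAvg u v c (replicaDeriv (v a) f) := by
  classical
  have hmp := measurePreserving_update_gaussPi a
  have key : ∀ F : (A → ℝ) → ℝ, Continuous F → Integrable F (gaussPi A) →
      ∫ x, F x ∂(gaussPi A) =
        ∫ x, ∫ s, F (Function.update x a s) ∂(gaussianReal 0 1) ∂(gaussPi A) := by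
    intro F hFc hF
    have h1 : Integrable (fun p : (A → ℝ) × ℝ => F (Function.update p.1 a p.2))
        ((gaussPi A).prod (gaussianReal 0 1)) := hmp.integrable_comp_of_integrable hF
    conv_lhs => rw [← hmp.map_eq]
    rw [integral_map hmp.measurable.aemeasurable hFc.aestronglyMeasurable,
      integral_prod _ h1]
  rw [key (fun x => x a * replicaAvg (linHam u v c x) f)
    ((continuous_apply a).mul (continuous_replicaAvg_linHam u v c f))
    (integrable_mul_replicaAvg_linHam u v c f a), gaussAvg, ← integral_const_mul,
    key (fun x => c a * replicaAvg (linHam u v c x) (replicaDeriv (v a) f))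
      (continuous_const.mul (continuous_replicaAvg_linHam u v c _))
    ((integrable_replicaAvg_linHam u v c _).const_mul _)]
  refine integral_congr_ae (Filter.Eventually.of_forall fun x => ?_)
  simp only [Function.update_self]
  have hder : ∀ s, HasDerivAt
      (fun s => replicaAvg (linHam u v c (Function.update x a s)) f)
      (c a * replicaAvg (linHam u v c (Function.update x a s)) (replicaDeriv (v a) f)) s := by
    intro s
    have hH : ∀ σ, HasDerivAt (fun s => linHam u v c (Function.update x a s) σ)
        (c a * v a σ) s := by
      intro σ
      unfold linHam
      refine HasDerivAt.const_add _ ?_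
      have h2 : ∀ b ∈ (Finset.univ : Finset A), HasDerivAt
          (fun s => c b * Function.update x a s b * v b σ)
          (if b = a then c a * v a σ else 0) s := by
        intro b _
        by_cases hb : b = a
        · subst hb
          simpa using ((hasDerivAt_id s).const_mul (c b)).mul_const (v b σ)
        · simp only [Function.update_of_ne hb, if_neg hb]
          exact hasDerivAt_const _ _
      refine (HasDerivAt.fun_sum h2).congr_deriv ?_
      simp
    refine (hasDerivAt_replicaAvg hH f).congr_deriv ?_
    unfold replicaAvg replicaDeriv
    rw [Finset.mul_sum]
    refine Finset.sum_congr rfl fun σs _ => ?_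
    rw [← Finset.mul_sum]
    ring
  refine integral_mul_gaussianReal hder (fun s => abs_replicaAvg_le _ _) (fun s => ?_)
    (K' := |c a| * ∑ σs, |replicaDeriv (v a) f σs|)
  rw [abs_mul]
  exact mul_le_mul_of_nonneg_left (abs_replicaAvg_le _ _) (abs_nonneg _)

lemma hasDerivAt_gaussAvg {n : ℕ} (u : C → ℝ) (v : A → C → ℝ) {c c' : ℝ → A → ℝ} {t K : ℝ}
    (hc : ∀ᶠ s in nhds t, ∀ a, HasDerivAt (fun s => c s a) (c' s a) s ∧ |c' s a| ≤ K)
    (f : (Fin n → C) → ℝ) :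
    HasDerivAt (fun s => gaussAvg u v (c s) f)
      (∑ a, c' t a * c t a * gaussAvg u v (c t) (replicaDeriv (v a) (replicaDeriv (v a) f))) t := by
  obtain ⟨U, hU, hUc⟩ := Filter.eventually_iff_exists_mem.1 hc
  have hHder : ∀ (x : A → ℝ), ∀ s ∈ U, ∀ σ, HasDerivAt (fun s => linHam u v (c s) x σ)
      (∑ a, c' s a * x a * v a σ) s := fun x s hs σ =>
    HasDerivAt.const_add _ <| HasDerivAt.fun_sum fun a _ =>
      (((hUc s hs a).1.mul_const (x a)).mul_const (v a σ))
  set B : A → ℝ := fun a => ∑ σ, |v a σ| with hB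
  have hvB : ∀ a σ, |v a σ| ≤ B a := fun a σ =>
    Finset.single_le_sum (f := fun σ => |v a σ|) (fun τ _ => abs_nonneg _) (mem_univ σ)
  have main := hasDerivAt_integral_of_dominated_loc_of_deriv_le (μ := gaussPi A) (x₀ := t)
    (F := fun s x => replicaAvg (linHam u v (c s) x) f)
    (F' := fun s x => replicaAvg (linHam u v (c s) x)
      (replicaDeriv (fun σ => ∑ a, c' s a * x a * v a σ) f))
    (bound := fun x => (∑ σs, |f σs|) * (2 * n * ∑ a, K * |x a| * B a)) hU
    (Filter.Eventually.of_forall fun s =>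
      (continuous_replicaAvg_linHam u v (c s) f).aestronglyMeasurable)
    (integrable_replicaAvg_linHam u v (c t) f) ?_ ?_ ?_ ?_
  · refine main.2.congr_deriv ?_
    simp_rw [replicaAvg_replicaDeriv_sum]
    rw [integral_finsetSum]
    · refine Finset.sum_congr rfl fun a _ => ?_
      simp_rw [mul_assoc]
      rw [integral_const_mul, integral_mul_replicaAvg]
    · intro a _
      simp_rw [mul_assoc]
      exact (integrable_mul_replicaAvg_linHam u v (c t) _ a).const_mul _
  · simp_rw [replicaAvg_replicaDeriv_sum]
    refine Continuous.aestronglyMeasurable (continuous_finsetSum _ fun a _ => ?_)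
    exact (continuous_const.mul (continuous_apply a)).mul (continuous_replicaAvg_linHam u v _ _)
  · refine Filter.Eventually.of_forall fun x s hs => ?_
    refine abs_replicaAvg_replicaDeriv_le _ _ _ fun σ => ?_
    refine (Finset.abs_sum_le_sum_abs _ _).trans (Finset.sum_le_sum fun a _ => ?_)
    rw [abs_mul, abs_mul]
    have := (hUc s hs a).2
    have h3 := hvB a σ
    have hK : 0 ≤ K := (abs_nonneg _).trans this
    gcongr
  · refine Integrable.const_mul (Integrable.const_mul (integrable_finsetSum _ fun a _ => ?_) _) _
    exact ((integrable_eval_gaussPi a).abs.const_mul K).mul_const _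
  · exact Filter.Eventually.of_forall fun x s hs => hasDerivAt_replicaAvg (hHder x s hs) f

lemma continuous_gaussAvg {n : ℕ} (u : C → ℝ) (v : A → C → ℝ) {c : ℝ → A → ℝ}
    (hc : ∀ a, Continuous fun s => c s a) (f : (Fin n → C) → ℝ) :
    Continuous fun s => gaussAvg u v (c s) f := by
  refine continuous_of_dominated (bound := fun _ => ∑ σs, |f σs|)
    (fun s => (continuous_replicaAvg_linHam u v (c s) f).aestronglyMeasurable)
    (fun s => Filter.Eventually.of_forall fun x => abs_replicaAvg_le _ _)
    (integrable_const _) (Filter.Eventually.of_forall fun x => ?_)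
  refine continuous_replicaAvg (fun σ => ?_) f
  unfold linHam
  fun_prop

end gaussAvg

/-! ### Affine variance paths -/

/-- The coefficients of the replicas in `replicaDeriv`: `-n` for the new one, `1` otherwise. -/
def replicaCoeff (n : ℕ) : Fin (n + 1) → ℝ := Fin.cons (-(n : ℝ)) fun _ => 1

/-- The generator on replica functions associated with a symmetric kernel `Γ`. -/
def replicaGen {C : Type*} {n : ℕ} (Γ : C → C → ℝ) (f : (Fin n → C) → ℝ)
    (σs : Fin (n + 2) → C) : ℝ :=
  f (fun l => σs l.succ.succ) *
    ∑ i : Fin (n + 1), ∑ j : Fin (n + 2),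
      replicaCoeff n i * replicaCoeff (n + 1) j * Γ (σs i.succ) (σs j)

lemma replicaDeriv_eq {C : Type*} {n : ℕ} (v : C → ℝ) (f : (Fin n → C) → ℝ)
    (σs : Fin (n + 1) → C) :
    replicaDeriv v f σs =
      f (fun l => σs l.succ) * ∑ i : Fin (n + 1), replicaCoeff n i * v (σs i) := by
  rw [Fin.sum_univ_succ]
  simp only [replicaDeriv, replicaCoeff, Fin.cons_zero, Fin.cons_succ, one_mul]
  ring

lemma sum_replicaCoeff (n : ℕ) : ∑ i, replicaCoeff n i = 0 := by
  rw [Fin.sum_univ_succ]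
  simp [replicaCoeff]

lemma abs_replicaCoeff_le (n : ℕ) (i : Fin (n + 1)) : |replicaCoeff n i| ≤ n + 1 := by
  refine Fin.cases ?_ (fun j => ?_) i
  · simp [replicaCoeff]
  · simp [replicaCoeff]

lemma replicaGen_add_const {C : Type*} {n : ℕ} (Γ : C → C → ℝ) (d : ℝ) (f : (Fin n → C) → ℝ) :
    replicaGen (fun σ τ => Γ σ τ + d) f = replicaGen Γ f := by
  funext σs
  unfold replicaGen
  congr 1
  have h : ∑ i : Fin (n + 1), ∑ j : Fin (n + 2), replicaCoeff n i * replicaCoeff (n + 1) j * d =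
      0 := by
    simp_rw [mul_assoc, ← Finset.mul_sum]
    rw [← Finset.sum_mul, sum_replicaCoeff, zero_mul]
  simp_rw [mul_add, Finset.sum_add_distrib]
  rw [h, add_zero]

/-- The sum of `|D (σ_i) (σ_j)|` over pairs of distinct replicas. -/
def pairDev {C : Type*} {n : ℕ} (D : C → C → ℝ) (σs : Fin n → C) : ℝ :=
  ∑ i, ∑ j, if i = j then 0 else |D (σs i) (σs j)|

lemma pairDev_nonneg {C : Type*} {n : ℕ} (D : C → C → ℝ) (σs : Fin n → C) :
    0 ≤ pairDev D σs :=
  Finset.sum_nonneg fun i _ => Finset.sum_nonneg fun j _ => by split_ifs <;> positivity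

lemma pairDev_comp_succ_le {C : Type*} {n : ℕ} (D : C → C → ℝ) (σs : Fin (n + 1) → C) :
    pairDev D (fun l => σs l.succ) ≤ pairDev D σs := by
  unfold pairDev
  rw [Fin.sum_univ_succ]
  refine le_add_of_nonneg_of_le (Finset.sum_nonneg fun j _ => by split_ifs <;> positivity) ?_
  refine Finset.sum_le_sum fun i _ => ?_
  rw [Fin.sum_univ_succ]
  refine le_add_of_nonneg_of_le (by split_ifs <;> positivity) ?_
  exact le_of_eq (Finset.sum_congr rfl fun j _ => by simp [Fin.succ_inj])

lemma abs_replicaGen_le {C : Type*} {n : ℕ} {Γ D : C → C → ℝ} {d : ℝ} (hd : ∀ σ, Γ σ σ = d)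
    (hΓ : ∀ σ τ, |Γ σ τ| ≤ |D σ τ|) (f : (Fin n → C) → ℝ) (σs : Fin (n + 2) → C) :
    |replicaGen Γ f σs| ≤
      |f (fun l => σs l.succ.succ)| * (((n : ℝ) + 2) ^ 2 * pairDev D σs) := by
  have h0 : ∀ i : Fin (n + 1), ∑ j : Fin (n + 2),
      replicaCoeff n i * replicaCoeff (n + 1) j * Γ (σs i.succ) (σs j) =
      (∑ j : Fin (n + 2), if i.succ = j then 0 else
        replicaCoeff n i * replicaCoeff (n + 1) j * Γ (σs i.succ) (σs j)) +
        replicaCoeff n i * d := by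
    intro i
    have h1 : replicaCoeff n i * d =
        ∑ j : Fin (n + 2), if i.succ = j then replicaCoeff n i * d else 0 := by simp
    rw [h1, ← Finset.sum_add_distrib]
    refine Finset.sum_congr rfl fun j _ => ?_
    by_cases hij : i.succ = j
    · subst hij
      simp [hd, replicaCoeff]
    · simp [hij]
  unfold replicaGen
  rw [abs_mul]
  refine mul_le_mul_of_nonneg_left ?_ (abs_nonneg _)
  simp_rw [h0]
  rw [Finset.sum_add_distrib, ← Finset.sum_mul, sum_replicaCoeff, zero_mul, add_zero]
  unfold pairDev
  rw [Finset.mul_sum]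
  calc _ ≤ ∑ i : Fin (n + 1), ((n : ℝ) + 2) ^ 2 *
        ∑ j : Fin (n + 2), (if i.succ = j then 0 else |D (σs i.succ) (σs j)|) := by
        refine (Finset.abs_sum_le_sum_abs _ _).trans (Finset.sum_le_sum fun i _ => ?_)
        rw [Finset.mul_sum]
        refine (Finset.abs_sum_le_sum_abs _ _).trans (Finset.sum_le_sum fun j _ => ?_)
        split_ifs
        · simp
        · rw [abs_mul, abs_mul, pow_two]
          have h1 := abs_replicaCoeff_le n i
          have h2 := abs_replicaCoeff_le (n + 1) j
          push_cast at h2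
          have h3 := hΓ (σs i.succ) (σs j)
          refine mul_le_mul (mul_le_mul (by linarith) (by linarith) (abs_nonneg _) (by positivity))
            h3 (abs_nonneg _) (by positivity)
    _ ≤ _ := by
        rw [Fin.sum_univ_succ (n := n + 1)]
        refine le_add_of_nonneg_left (mul_nonneg (by positivity) ?_)
        exact Finset.sum_nonneg fun j _ => by split_ifs <;> positivity

lemma hasDerivAt_gaussAvg_sqrt {A C : Type*} [Fintype A] [Fintype C] [Nonempty C] {n : ℕ}
    (u : C → ℝ) (v : A → C → ℝ) {α δ : A → ℝ} {t : ℝ} (h : ∀ a, δ a = 0 ∨ 0 < α a + δ a * t)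
    {Γ : C → C → ℝ} (hΓ : ∀ σ τ, ∑ a, δ a / 2 * (v a σ * v a τ) = Γ σ τ)
    (f : (Fin n → C) → ℝ) :
    HasDerivAt (fun s => gaussAvg u v (fun a => Real.sqrt (α a + δ a * s)) f)
      (gaussAvg u v (fun a => Real.sqrt (α a + δ a * t)) (replicaGen Γ f)) t := by
  set c' : ℝ → A → ℝ := fun s a => δ a / (2 * Real.sqrt (α a + δ a * s)) with hc'
  have hev : ∀ᶠ s in nhds t, ∀ a,
      HasDerivAt (fun s => Real.sqrt (α a + δ a * s)) (c' s a) s ∧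
        |c' s a| ≤ ∑ b, |c' t b| + 1 := by
    refine Filter.eventually_all.2 fun a => ?_
    have hle : |c' t a| ≤ ∑ b, |c' t b| :=
      Finset.single_le_sum (f := fun b => |c' t b|) (fun b _ => abs_nonneg _) (mem_univ a)
    rcases h a with h0 | hpos
    · refine Filter.Eventually.of_forall fun s => ⟨?_, ?_⟩
      · simp only [hc', h0, zero_mul, zero_div]
        exact hasDerivAt_const _ _
      · have : c' s a = 0 := by simp [hc', h0]
        rw [this, abs_zero]
        positivity
    · have hcont : ContinuousAt (fun s => |c' s a|) t := by
        refine ContinuousAt.abs (ContinuousAt.div continuousAt_const (by fun_prop) ?_)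
        have := Real.sqrt_pos.2 hpos
        positivity
      have hcont2 : ContinuousAt (fun s => α a + δ a * s) t := by fun_prop
      filter_upwards [hcont.eventually_lt_const (lt_add_one _), hcont2.eventually_const_lt hpos]
        with s hs1 hs2
      refine ⟨?_, by linarith⟩
      have := (((hasDerivAt_id s).const_mul (δ a)).const_add (α a)).sqrt hs2.ne'
      simpa using this
  refine (hasDerivAt_gaussAvg u v hev f).congr_deriv ?_
  have hcc : ∀ a, c' t a * Real.sqrt (α a + δ a * t) = δ a / 2 := by
    intro a
    rcases h a with h0 | hpos
    · simp [hc', h0]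
    · have := (Real.sqrt_pos.2 hpos).ne'
      simp only [hc']
      field_simp
  simp_rw [hcc]
  unfold gaussAvg
  simp_rw [← integral_const_mul]
  rw [← integral_finsetSum]
  · refine integral_congr_ae (Filter.Eventually.of_forall fun x => ?_)
    simp only [replicaAvg, Finset.mul_sum]
    rw [Finset.sum_comm]
    refine Finset.sum_congr rfl fun σs _ => ?_
    simp only [replicaDeriv_eq, replicaGen, ← hΓ]
    simp_rw [← mul_assoc]
    rw [← Finset.sum_mul]
    congr 1
    simp_rw [mul_assoc, Finset.sum_mul_sum, Finset.mul_sum]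
    rw [Finset.sum_comm]
    refine Finset.sum_congr rfl fun i _ => ?_
    rw [Finset.sum_comm]
    refine Finset.sum_congr rfl fun j _ => ?_
    refine Finset.sum_congr rfl fun a _ => ?_
    ring
  · exact fun a _ => (integrable_replicaAvg_linHam u v _ _).const_mul _

/-! ### The SK model as a Gaussian Hamiltonian -/

/-- Indices of the Gaussians: one for each ordered pair of sites, and one for each site. -/
abbrev SKIdx (M : ℕ) := (Fin (M + 1) × Fin (M + 1)) ⊕ Fin (M + 1)

/-- The external field term. -/
def skExt (M : ℕ) (h : ℝ) (σ : Cfg (M + 1)) : ℝ := h * ∑ i, spin (σ i)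

/-- The functions multiplying the Gaussians: pair interactions and random external fields. -/
def skField (M : ℕ) (β q : ℝ) : SKIdx M → Cfg (M + 1) → ℝ :=
  Sum.elim
    (fun p σ => if p.1 < p.2 then
      β / Real.sqrt (M + 1) * (spin (σ p.1) * spin (σ p.2)) else 0)
    (fun i σ => β * Real.sqrt q * spin (σ i))

/-- Variances at time `0` of the one-coordinate path. -/
def cavityBase (M : ℕ) : SKIdx M → ℝ :=
  Sum.elim (fun p => if p.2 = Fin.last M then 0 else 1) (fun i => if i = Fin.last M then 1 else 0)

/-- Variance slopes of the one-coordinate path. -/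
def cavitySlope (M : ℕ) : SKIdx M → ℝ :=
  Sum.elim (fun p => if p.2 = Fin.last M then 1 else 0) (fun i => if i = Fin.last M then -1 else 0)

/-- Variances at time `0` of the path decoupling all sites. -/
def decoupledBase (M : ℕ) : SKIdx M → ℝ := Sum.elim (fun _ => 0) (fun _ => 1)

/-- Variance slopes of the path decoupling all sites. -/
def decoupledSlope (M : ℕ) : SKIdx M → ℝ := Sum.elim (fun _ => 1) (fun _ => -1)

lemma spin_mul_self (b : Bool) : spin b * spin b = 1 := by
  cases b <;> simp [spin]

lemma abs_spin (b : Bool) : |spin b| = 1 := by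
  cases b <;> simp [spin]

lemma measurePreserving_curry_gaussPi (N : ℕ) :
    MeasurePreserving (fun (x : Fin N × Fin N → ℝ) i j => x (i, j)) (gaussPi (Fin N × Fin N))
      (gaussN N) := by
  have h : MeasurePreserving (MeasurableEquiv.curry (Fin N) (Fin N) ℝ).symm (gaussN N)
      (gaussPi (Fin N × Fin N)) := by
    refine ⟨(MeasurableEquiv.curry (Fin N) (Fin N) ℝ).symm.measurable, ?_⟩
    symm
    refine Measure.pi_eq fun s hs => ?_
    rw [Measure.map_apply (MeasurableEquiv.curry (Fin N) (Fin N) ℝ).symm.measurable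
      (MeasurableSet.univ_pi hs)]
    have : (MeasurableEquiv.curry (Fin N) (Fin N) ℝ).symm ⁻¹' (Set.univ.pi s) =
        Set.univ.pi fun i => Set.univ.pi fun j => s (i, j) := by
      ext g
      simp only [Set.mem_preimage, Set.mem_pi, Set.mem_univ, forall_true_left]
      exact ⟨fun h i j => h (i, j), fun h p => h p.1 p.2⟩
    rw [this, gaussN, Measure.pi_pi]
    simp_rw [Measure.pi_pi]
    rw [Fintype.prod_prod_type]
  exact h.symm (MeasurableEquiv.curry (Fin N) (Fin N) ℝ).symm

lemma measurePreserving_disorder (M : ℕ) :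
    MeasurePreserving (fun x : SKIdx M → ℝ =>
        ((fun i j => x (Sum.inl (i, j)) : Fin (M + 1) → Fin (M + 1) → ℝ), x (Sum.inr (Fin.last M))))
      (gaussPi (SKIdx M)) ((gaussN (M + 1)).prod (gaussianReal 0 1)) := by
  have h1 := measurePreserving_sumPiEquivProdPi
    (ι := Fin (M + 1) × Fin (M + 1)) (ι' := Fin (M + 1)) (fun _ => gaussianReal 0 1)
  have h2 := (measurePreserving_curry_gaussPi (M + 1)).prod
    (measurePreserving_eval (fun _ : Fin (M + 1) => gaussianReal 0 1) (Fin.last M))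
  exact h2.comp h1

lemma negHt_eq_linHam (M : ℕ) (β h q s : ℝ) (x : SKIdx M → ℝ) (σ : Cfg (M + 1)) :
    negHt M β h q s (fun i j => x (Sum.inl (i, j))) (x (Sum.inr (Fin.last M))) σ =
      linHam (skExt M h) (skField M β q)
        (fun a => Real.sqrt (cavityBase M a + cavitySlope M a * s)) x σ := by
  have h1 : ∀ i : Fin M, i.castSucc < Fin.last M := Fin.castSucc_lt_last
  have h2 : ∀ i : Fin M, i.castSucc ≠ Fin.last M := fun i => (h1 i).ne
  have h3 : ∀ i : Fin M, ¬ Fin.last M < i.castSucc := fun i => (h1 i).not_gt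
  unfold negHt linHam skExt
  rw [Fintype.sum_sum_type, Fintype.sum_prod_type]
  simp only [skField, cavityBase, cavitySlope, Sum.elim_inl, Sum.elim_inr, Fin.sum_univ_castSucc,
    h1, h2, h3, if_true, if_false, Fin.castSucc_lt_castSucc_iff, lt_irrefl, mul_zero,
    Finset.sum_const_zero, add_zero, zero_add, zero_mul, one_mul, Real.sqrt_one, Real.sqrt_zero,
    Finset.mul_sum, mul_ite, Finset.sum_add_distrib]
  have e1 : ∀ i : Fin M, ∀ j : Fin M,
      (if i < j then x (Sum.inl (i.castSucc, j.castSucc)) *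
        (β / Real.sqrt (M + 1) * (spin (σ i.castSucc) * spin (σ j.castSucc))) else 0) =
      (if i < j then β / Real.sqrt (M + 1) * (x (Sum.inl (i.castSucc, j.castSucc)) *
        spin (σ i.castSucc) * spin (σ j.castSucc)) else 0) := by
    intro i j
    split_ifs <;> ring
  simp_rw [e1]
  have e2 : ∀ i : Fin M, Real.sqrt s * x (Sum.inl (i.castSucc, Fin.last M)) *
      (β / Real.sqrt (M + 1) * (spin (σ i.castSucc) * spin (σ (Fin.last M)))) =
      Real.sqrt s * (spin (σ (Fin.last M)) * (β / Real.sqrt (M + 1)) *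
        (x (Sum.inl (i.castSucc, Fin.last M)) * spin (σ i.castSucc))) := by
    intro i; ring
  simp_rw [e2]
  rw [show 1 + -1 * s = 1 - s by ring]
  ring

lemma gibbsT_eq_replicaAvg (M : ℕ) (β h q s : ℝ) (g : Fin (M + 1) → Fin (M + 1) → ℝ) (z : ℝ)
    {n : ℕ} (f : (Fin n → Cfg (M + 1)) → ℝ) :
    gibbsT M β h q s g z f = replicaAvg (negHt M β h q s g z) f := by
  unfold gibbsT replicaAvg gibbsProb
  rw [Finset.sum_div]
  refine Finset.sum_congr rfl fun σs _ => ?_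
  rw [Finset.prod_div_distrib, Finset.prod_const, Finset.card_univ, mul_div_assoc]

lemma nuT_eq_gaussAvg (M : ℕ) (β h q s : ℝ) {n : ℕ} (f : (Fin n → Cfg (M + 1)) → ℝ) :
    nuT M β h q s f = gaussAvg (skExt M h) (skField M β q)
      (fun a => Real.sqrt (cavityBase M a + cavitySlope M a * s)) f := by
  have hmp := measurePreserving_disorder M
  unfold nuT gaussAvg
  rw [← hmp.map_eq, integral_map hmp.measurable.aemeasurable]
  · refine integral_congr_ae (Filter.Eventually.of_forall fun x => ?_)
    simp only [gibbsT_eq_replicaAvg]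
    congr 1
    funext σ
    exact negHt_eq_linHam M β h q s x σ
  · refine Continuous.aestronglyMeasurable ?_
    simp only [gibbsT_eq_replicaAvg]
    refine continuous_replicaAvg (fun σ => ?_) f
    unfold negHt
    refine Continuous.add (Continuous.add (Continuous.add (Continuous.mul continuous_const
      (continuous_finsetSum _ fun i _ => continuous_finsetSum _ fun j _ => ?_)) ?_) ?_) ?_
    · split_ifs <;> fun_prop
    · fun_prop
    · fun_prop
    · fun_prop

lemma cavity_covariance (M : ℕ) {β q : ℝ} (hq : 0 ≤ q) (σ τ : Cfg (M + 1)) :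
    ∑ a, cavitySlope M a / 2 * (skField M β q a σ * skField M β q a τ) =
      β ^ 2 / 2 * (spin (σ (Fin.last M)) * spin (τ (Fin.last M)) * (overlapMinus M σ τ - q)) := by
  have h1 : ∀ i : Fin M, i.castSucc < Fin.last M := Fin.castSucc_lt_last
  have h2 : ∀ i : Fin M, i.castSucc ≠ Fin.last M := fun i => (h1 i).ne
  have hb : β / Real.sqrt (M + 1) * (β / Real.sqrt (M + 1)) = β ^ 2 / (M + 1) := by
    rw [div_mul_div_comm, Real.mul_self_sqrt (by positivity), pow_two]
  have hq' : Real.sqrt q * Real.sqrt q = q := Real.mul_self_sqrt hq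
  rw [Fintype.sum_sum_type, Fintype.sum_prod_type]
  simp only [skField, cavitySlope, Sum.elim_inl, Sum.elim_inr, Fin.sum_univ_castSucc,
    h1, h2, if_true, if_false, lt_irrefl, mul_zero, zero_mul, zero_div,
    Finset.sum_const_zero, add_zero, zero_add, overlapMinus]
  rw [mul_sub, mul_sub, Finset.sum_div, Finset.mul_sum, Finset.mul_sum, sub_eq_add_neg]
  congr 1
  · refine Finset.sum_congr rfl fun i _ => ?_
    linear_combination (1 / 2 * spin (σ i.castSucc) * spin (σ (Fin.last M)) *
      spin (τ i.castSucc) * spin (τ (Fin.last M))) * hb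
  · linear_combination (-(1 / 2) * β ^ 2 * spin (σ (Fin.last M)) * spin (τ (Fin.last M))) * hq'

lemma sum_pairs_lt {N : ℕ} (y : Fin N → ℝ) :
    (∑ i, y i) ^ 2 = 2 * (∑ i, ∑ j, if i < j then y i * y j else 0) + ∑ i, y i ^ 2 := by
  have h1 : ∀ i j : Fin N, y i * y j = (if i < j then y i * y j else 0) +
      (if j < i then y j * y i else 0) + (if i = j then y i ^ 2 else 0) := by
    intro i j
    rcases lt_trichotomy i j with h | h | h
    · simp [h, h.ne, h.not_gt]
    · subst h; simp [pow_two]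
    · simp [h, h.ne', h.not_gt, mul_comm]
  rw [pow_two, Finset.sum_mul_sum,
    Finset.sum_congr rfl fun i _ => Finset.sum_congr rfl fun j _ => h1 i j]
  simp only [Finset.sum_add_distrib]
  rw [Finset.sum_comm (f := fun i j => if j < i then y j * y i else 0)]
  simp only [Finset.sum_ite_eq, mem_univ, if_true]
  ring

lemma decoupled_covariance (M : ℕ) {β q : ℝ} (hq : 0 ≤ q) (σ τ : Cfg (M + 1)) :
    ∑ a, decoupledSlope M a / 2 * (skField M β q a σ * skField M β q a τ) =
      β ^ 2 / 4 * ((M + 1) * (overlap (M + 1) σ τ - q) ^ 2) +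
        -(β ^ 2 / 4 * ((M + 1) * q ^ 2 + 1)) := by
  have hb : β / Real.sqrt (M + 1) * (β / Real.sqrt (M + 1)) = β ^ 2 / (M + 1) := by
    rw [div_mul_div_comm, Real.mul_self_sqrt (by positivity), pow_two]
  have hs0 : (M : ℝ) + 1 ≠ 0 := by positivity
  have hq' : Real.sqrt q ^ 2 = q := Real.sq_sqrt hq
  have hy := sum_pairs_lt fun i => spin (σ i) * spin (τ i)
  have hy2 : ∑ i, (spin (σ i) * spin (τ i)) ^ 2 = M + 1 := by
    have : ∀ i, (spin (σ i) * spin (τ i)) ^ 2 = 1 := fun i => by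
      rw [mul_pow, pow_two, pow_two, spin_mul_self, spin_mul_self, one_mul]
    simp [this]
  rw [hy2] at hy
  rw [Fintype.sum_sum_type, Fintype.sum_prod_type]
  simp only [skField, decoupledSlope, Sum.elim_inl, Sum.elim_inr, overlap]
  have e1 : ∀ i j : Fin (M + 1), (1 : ℝ) / 2 *
      ((if i < j then β / Real.sqrt (M + 1) * (spin (σ i) * spin (σ j)) else 0) *
        if i < j then β / Real.sqrt (M + 1) * (spin (τ i) * spin (τ j)) else 0) =
      1 / 2 * (β ^ 2 / (M + 1)) * (if i < j then
        (spin (σ i) * spin (τ i)) * (spin (σ j) * spin (τ j)) else 0) := by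
    intro i j
    split_ifs
    · linear_combination (1 / 2 * spin (σ i) * spin (σ j) * spin (τ i) * spin (τ j)) * hb
    · simp
  have e2 : ∀ i : Fin (M + 1), (-1 : ℝ) / 2 *
      (β * Real.sqrt q * spin (σ i) * (β * Real.sqrt q * spin (τ i))) =
      -(β ^ 2 * q / 2) * (spin (σ i) * spin (τ i)) := by
    intro i
    linear_combination (-(1 / 2) * β ^ 2 * spin (σ i) * spin (τ i)) * hq'
  simp_rw [e1, e2, ← Finset.mul_sum]
  push_cast
  set S := ∑ i, spin (σ i) * spin (τ i)
  set P := ∑ i, ∑ j, if i < j then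
    (spin (σ i) * spin (τ i)) * (spin (σ j) * spin (τ j)) else 0
  have hP : P = (S ^ 2 - (M + 1)) / 2 := by linarith
  rw [hP]
  field_simp
  ring

/-! ### Gaussian averages as positive linear functionals -/

section weights

variable {A C : Type*} [Fintype A] [Fintype C]

/-- The averaged weight of a tuple of replicas. -/
def gaussWeight {n : ℕ} (u : C → ℝ) (v : A → C → ℝ) (c : A → ℝ) (σs : Fin n → C) : ℝ :=
  ∫ x, ∏ l, gibbsProb (linHam u v c x) (σs l) ∂(gaussPi A)

lemma gaussWeight_nonneg {n : ℕ} (u : C → ℝ) (v : A → C → ℝ) (c : A → ℝ) (σs : Fin n → C) :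
    0 ≤ gaussWeight u v c σs :=
  integral_nonneg fun _ => prod_gibbsProb_nonneg _ _

variable [Nonempty C]

lemma integrable_prod_gibbsProb {n : ℕ} (u : C → ℝ) (v : A → C → ℝ) (c : A → ℝ)
    (σs : Fin n → C) :
    Integrable (fun x => ∏ l, gibbsProb (linHam u v c x) (σs l)) (gaussPi A) := by
  classical
  have h := integrable_replicaAvg_linHam u v c fun τs => if τs = σs then (1 : ℝ) else 0
  refine h.congr (Filter.Eventually.of_forall fun x => ?_)
  simp [replicaAvg]

lemma gaussAvg_eq_sum {n : ℕ} (u : C → ℝ) (v : A → C → ℝ) (c : A → ℝ) (f : (Fin n → C) → ℝ) :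
    gaussAvg u v c f = ∑ σs, f σs * gaussWeight u v c σs := by
  unfold gaussAvg replicaAvg gaussWeight
  rw [integral_finsetSum _ fun σs _ => (integrable_prod_gibbsProb u v c σs).const_mul _]
  simp_rw [integral_const_mul]

lemma gaussAvg_mono {n : ℕ} (u : C → ℝ) (v : A → C → ℝ) (c : A → ℝ) {f g : (Fin n → C) → ℝ}
    (hfg : ∀ σs, f σs ≤ g σs) : gaussAvg u v c f ≤ gaussAvg u v c g := by
  simp_rw [gaussAvg_eq_sum]
  exact Finset.sum_le_sum fun σs _ =>
    mul_le_mul_of_nonneg_right (hfg σs) (gaussWeight_nonneg u v c σs)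

lemma gaussAvg_const_mul {n : ℕ} (u : C → ℝ) (v : A → C → ℝ) (c : A → ℝ) (k : ℝ)
    (f : (Fin n → C) → ℝ) : gaussAvg u v c (fun σs => k * f σs) = k * gaussAvg u v c f := by
  simp_rw [gaussAvg_eq_sum, Finset.mul_sum, mul_assoc]

lemma gaussAvg_add {n : ℕ} (u : C → ℝ) (v : A → C → ℝ) (c : A → ℝ)
    (f g : (Fin n → C) → ℝ) :
    gaussAvg u v c (fun σs => f σs + g σs) = gaussAvg u v c f + gaussAvg u v c g := by
  simp_rw [gaussAvg_eq_sum, add_mul, Finset.sum_add_distrib]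

lemma gaussAvg_sum {n : ℕ} {ι : Type*} (s : Finset ι) (u : C → ℝ) (v : A → C → ℝ) (c : A → ℝ)
    (f : ι → (Fin n → C) → ℝ) :
    gaussAvg u v c (fun σs => ∑ i ∈ s, f i σs) = ∑ i ∈ s, gaussAvg u v c (f i) := by
  simp_rw [gaussAvg_eq_sum, Finset.sum_mul]
  rw [Finset.sum_comm]

lemma gaussAvg_nonneg {n : ℕ} (u : C → ℝ) (v : A → C → ℝ) (c : A → ℝ) {f : (Fin n → C) → ℝ}
    (hf : ∀ σs, 0 ≤ f σs) : 0 ≤ gaussAvg u v c f := by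
  rw [gaussAvg_eq_sum]
  exact Finset.sum_nonneg fun σs _ => mul_nonneg (hf σs) (gaussWeight_nonneg u v c σs)

lemma abs_gaussAvg_le {n : ℕ} (u : C → ℝ) (v : A → C → ℝ) (c : A → ℝ) (f : (Fin n → C) → ℝ) :
    |gaussAvg u v c f| ≤ gaussAvg u v c fun σs => |f σs| := by
  simp_rw [gaussAvg_eq_sum]
  refine (Finset.abs_sum_le_sum_abs _ _).trans (le_of_eq (Finset.sum_congr rfl fun σs _ => ?_))
  rw [abs_mul, abs_of_nonneg (gaussWeight_nonneg u v c σs)]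

lemma gaussAvg_comp_injective {k n : ℕ} (u : C → ℝ) (v : A → C → ℝ) (c : A → ℝ)
    (f : (Fin k → C) → ℝ) {e : Fin k → Fin n} (he : Function.Injective e) :
    gaussAvg u v c (fun σs => f (fun j => σs (e j))) = gaussAvg u v c f := by
  unfold gaussAvg
  simp_rw [replicaAvg_comp_injective _ f he]

lemma gaussAvg_mul_le {n : ℕ} (u : C → ℝ) (v : A → C → ℝ) (c : A → ℝ) (f g : (Fin n → C) → ℝ) :
    gaussAvg u v c (fun σs => f σs * g σs) ≤
      Real.sqrt (gaussAvg u v c fun σs => f σs ^ 2) *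
        Real.sqrt (gaussAvg u v c fun σs => g σs ^ 2) := by
  simp_rw [gaussAvg_eq_sum]
  have h := Real.sum_mul_le_sqrt_mul_sqrt Finset.univ
    (fun σs => f σs * Real.sqrt (gaussWeight u v c σs))
    (fun σs => g σs * Real.sqrt (gaussWeight u v c σs))
  have hw : ∀ σs : Fin n → C, Real.sqrt (gaussWeight u v c σs) ^ 2 = gaussWeight u v c σs :=
    fun σs => Real.sq_sqrt (gaussWeight_nonneg u v c σs)
  simp_rw [mul_pow, hw] at h
  refine le_trans (le_of_eq (Finset.sum_congr rfl fun σs _ => ?_)) h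
  rw [mul_mul_mul_comm, ← pow_two, hw]

end weights

/-! ### The one-coordinate path -/

/-- The covariance slope along the one-coordinate path. -/
def cavityKernel (M : ℕ) (β q : ℝ) (σ τ : Cfg (M + 1)) : ℝ :=
  β ^ 2 / 2 * (spin (σ (Fin.last M)) * spin (τ (Fin.last M)) * (overlapMinus M σ τ - q))

lemma overlapMinus_self (M : ℕ) (σ : Cfg (M + 1)) : overlapMinus M σ σ = M / (M + 1) := by
  simp [overlapMinus, spin_mul_self]

lemma abs_overlapMinus_le (M : ℕ) (σ τ : Cfg (M + 1)) : |overlapMinus M σ τ| ≤ 1 := by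
  unfold overlapMinus
  rw [abs_div, abs_of_pos (by positivity : (0 : ℝ) < M + 1), div_le_one (by positivity)]
  refine (Finset.abs_sum_le_sum_abs _ _).trans ?_
  simp [abs_mul, abs_spin]

lemma abs_cavityKernel_le (M : ℕ) {β q : ℝ} (hβ : β ^ 2 ≤ 2) (σ τ : Cfg (M + 1)) :
    |cavityKernel M β q σ τ| ≤ |overlapMinus M σ τ - q| := by
  unfold cavityKernel
  rw [abs_mul, abs_mul, abs_mul, abs_spin, abs_spin, one_mul, one_mul,
    abs_of_nonneg (by positivity : 0 ≤ β ^ 2 / 2)]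
  exact mul_le_of_le_one_left (abs_nonneg _) (by linarith)

lemma cavityKernel_self (M : ℕ) (β q : ℝ) (σ : Cfg (M + 1)) :
    cavityKernel M β q σ σ = β ^ 2 / 2 * (M / (M + 1) - q) := by
  unfold cavityKernel
  rw [spin_mul_self, overlapMinus_self, one_mul]

lemma continuous_nuT (M : ℕ) (β h q : ℝ) {n : ℕ} (f : (Fin n → Cfg (M + 1)) → ℝ) :
    Continuous fun s => nuT M β h q s f := by
  simp_rw [nuT_eq_gaussAvg]
  exact continuous_gaussAvg _ _ (fun a => by fun_prop) f

lemma hasDerivAt_nuT (M : ℕ) (β h : ℝ) {q t : ℝ} (hq : 0 ≤ q) (ht : t ∈ Set.Ioo (0 : ℝ) 1)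
    {n : ℕ} (f : (Fin n → Cfg (M + 1)) → ℝ) :
    HasDerivAt (fun s => nuT M β h q s f)
      (nuT M β h q t (replicaGen (cavityKernel M β q) f)) t := by
  simp_rw [nuT_eq_gaussAvg]
  refine hasDerivAt_gaussAvg_sqrt _ _ (fun a => ?_) (cavity_covariance M hq) f
  obtain ⟨h0, h1⟩ := ht
  rcases a with p | i
  · by_cases hp : p.2 = Fin.last M
    · right; simpa [cavityBase, cavitySlope, hp] using h0
    · left; simp [cavitySlope, hp]
  · by_cases hi : i = Fin.last M
    · right; simpa [cavityBase, cavitySlope, hi] using h1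
    · left; simp [cavitySlope, hi]

lemma hasDerivWithinAt_nuT (M : ℕ) (β h : ℝ) {q t : ℝ} (hq : 0 ≤ q) (ht : t ∈ Set.Icc (0 : ℝ) 1)
    {n : ℕ} (f : (Fin n → Cfg (M + 1)) → ℝ) :
    HasDerivWithinAt (fun s => nuT M β h q s f)
      (nuT M β h q t (replicaGen (cavityKernel M β q) f)) (Set.Icc 0 1) t := by
  set G := fun s => nuT M β h q s (replicaGen (cavityKernel M β q) f) with hG
  have hGc : Continuous G := continuous_nuT M β h q _
  have h_eqOn : ∀ s ∈ Set.Icc (0 : ℝ) 1,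
      nuT M β h q s f = nuT M β h q 0 f + ∫ y in (0 : ℝ)..s, G y := by
    intro s hs
    rw [intervalIntegral.integral_eq_sub_of_hasDerivAt_of_le hs.1
      (continuous_nuT M β h q f).continuousOn
      (fun y hy => hasDerivAt_nuT M β h hq ⟨hy.1, hy.2.trans_le hs.2⟩ f)
      (hGc.intervalIntegrable _ _)]
    ring
  have hd : HasDerivAt (fun s => nuT M β h q 0 f + ∫ y in (0 : ℝ)..s, G y) (G t) t :=
    (hGc.integral_hasStrictDerivAt 0 t).hasDerivAt.const_add _
  exact hd.hasDerivWithinAt.congr h_eqOn (h_eqOn t ht)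

lemma pairDev_le {C : Type*} {n : ℕ} {D : C → C → ℝ} {B : ℝ} (hD : ∀ σ τ, |D σ τ| ≤ B)
    (σs : Fin n → C) : pairDev D σs ≤ n ^ 2 * B := by
  unfold pairDev
  calc _ ≤ ∑ _i : Fin n, ∑ _j : Fin n, B := by
        refine Finset.sum_le_sum fun i _ => Finset.sum_le_sum fun j _ => ?_
        split_ifs
        · exact (abs_nonneg _).trans (hD (σs i) (σs j))
        · exact hD _ _
    _ = _ := by simp; ring

/-- Averages of nonnegative functions along the path are controlled by those at the end point. -/
lemma nuT_le_exp_mul_nuT_one (M : ℕ) {β h q t : ℝ} (hβ : β ^ 2 ≤ 2) (hq : 0 ≤ q) (hq1 : q ≤ 1)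
    (ht : t ∈ Set.Icc (0 : ℝ) 1) {n : ℕ} {f : (Fin n → Cfg (M + 1)) → ℝ} (hf : ∀ σs, 0 ≤ f σs) :
    nuT M β h q t f ≤ Real.exp (2 * ((n : ℝ) + 2) ^ 4) * nuT M β h q 1 f := by
  set K : ℝ := 2 * ((n : ℝ) + 2) ^ 4 with hK
  have hD : ∀ σ τ : Cfg (M + 1), |overlapMinus M σ τ - q| ≤ 2 := by
    intro σ τ
    have := abs_le.1 (abs_overlapMinus_le M σ τ)
    rw [abs_le]; constructor <;> linarith
  have hbound : ∀ s, |nuT M β h q s (replicaGen (cavityKernel M β q) f)| ≤ K * nuT M β h q s f := by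
    intro s
    simp_rw [nuT_eq_gaussAvg]
    refine (abs_gaussAvg_le _ _ _ _).trans ?_
    rw [← gaussAvg_comp_injective (n := n + 2) _ _ _ f
      (e := fun l => l.succ.succ) (fun i j hij => by simpa using hij), ← gaussAvg_const_mul]
    refine gaussAvg_mono _ _ _ fun σs => ?_
    refine (abs_replicaGen_le (cavityKernel_self M β q) (abs_cavityKernel_le M hβ) f σs).trans ?_
    rw [abs_of_nonneg (hf _), mul_comm]
    refine mul_le_mul_of_nonneg_right ?_ (hf _)
    have := pairDev_le hD σs
    push_cast at this
    calc _ ≤ ((n : ℝ) + 2) ^ 2 * (((n : ℝ) + 2) ^ 2 * 2) := by gcongr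
      _ = K := by rw [hK]; ring
  have hnn : ∀ s, 0 ≤ nuT M β h q s f := fun s => by
    rw [nuT_eq_gaussAvg]; exact gaussAvg_nonneg _ _ _ hf
  have hmono : MonotoneOn (fun s => Real.exp (K * s) * nuT M β h q s f) (Set.Icc 0 1) := by
    refine monotoneOn_of_hasDerivWithinAt_nonneg (convex_Icc 0 1)
      (f' := fun s => Real.exp (K * s) * K * nuT M β h q s f +
        Real.exp (K * s) * nuT M β h q s (replicaGen (cavityKernel M β q) f)) ?_ ?_ ?_
    · exact (Continuous.mul (by fun_prop) (continuous_nuT M β h q f)).continuousOn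
    · intro s hs
      rw [interior_Icc] at hs
      have h1 : HasDerivAt (fun s => Real.exp (K * s)) (Real.exp (K * s) * K) s := by
        simpa using ((hasDerivAt_id s).const_mul K).exp
      exact (h1.mul (hasDerivAt_nuT M β h hq hs f)).hasDerivWithinAt
    · intro s _
      have h1 := (abs_le.1 (hbound s)).1
      rw [mul_assoc, ← mul_add]
      exact mul_nonneg (Real.exp_pos _).le (by linarith)
  have h1 := hmono ht (Set.right_mem_Icc.2 zero_le_one) ht.2
  simp only [mul_one] at h1
  refine le_trans ?_ h1
  refine le_mul_of_one_le_left (hnn t) (Real.one_le_exp ?_)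
  exact mul_nonneg (by positivity) ht.1

/-! ### Exponential moments along a path with positive covariance slope -/

lemma replicaGen_two_le {C : Type*} {Y : C → C → ℝ} {d : ℝ} (hY : ∀ σ τ, 0 ≤ Y σ τ)
    (hsymm : ∀ σ τ, Y σ τ = Y τ σ) (hd : ∀ σ, Y σ σ = d) {f : (Fin 2 → C) → ℝ}
    (hf : ∀ σs, 0 ≤ f σs) (σs : Fin 4 → C) :
    replicaGen Y f σs ≤ f ![σs 2, σs 3] * (2 * Y (σs 2) (σs 3) + 6 * Y (σs 1) (σs 0)) := by
  have hfe : f (fun l => σs l.succ.succ) = f ![σs 2, σs 3] := by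
    congr 1
    funext l
    fin_cases l <;> rfl
  unfold replicaGen
  rw [hfe]
  refine mul_le_mul_of_nonneg_left ?_ (hf _)
  have e2 : (Fin.succ 1 : Fin 3) = 2 := rfl
  have e3 : (Fin.succ 2 : Fin 4) = 3 := rfl
  simp only [replicaCoeff, Fin.sum_univ_succ, Fin.cons_zero, Fin.cons_succ, Fin.succ_zero_eq_one,
    Finset.univ_eq_empty, Finset.sum_empty, hd, e2, e3]
  push_cast
  have h1 := hsymm (σs 3) (σs 2)
  have h2 := hsymm (σs 2) (σs 1)
  have h3 := hsymm (σs 3) (σs 1)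
  have := hY (σs 1) (σs 2)
  have := hY (σs 1) (σs 3)
  have := hY (σs 2) (σs 0)
  have := hY (σs 3) (σs 0)
  linarith

section expMoment

variable {A C : Type*} [Fintype A] [Fintype C] [Nonempty C]

lemma gaussWeight_eq_gaussAvg [DecidableEq C] {n : ℕ} (u : C → ℝ) (v : A → C → ℝ) (c : A → ℝ)
    (σs : Fin n → C) :
    gaussWeight u v c σs = gaussAvg u v c fun τs => if τs = σs then (1 : ℝ) else 0 := by
  rw [gaussAvg_eq_sum]
  simp

lemma hasDerivAt_gaussAvg_sqrt_family {n : ℕ} (u : C → ℝ) (v : A → C → ℝ) {α δ : A → ℝ} {t : ℝ}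
    (h : ∀ a, δ a = 0 ∨ 0 < α a + δ a * t) {Γ : C → C → ℝ}
    (hΓ : ∀ σ τ, ∑ a, δ a / 2 * (v a σ * v a τ) = Γ σ τ) {F : ℝ → (Fin n → C) → ℝ}
    {F' : (Fin n → C) → ℝ} (hF : ∀ σs, HasDerivAt (fun s => F s σs) (F' σs) t) :
    HasDerivAt (fun s => gaussAvg u v (fun a => Real.sqrt (α a + δ a * s)) (F s))
      (gaussAvg u v (fun a => Real.sqrt (α a + δ a * t)) F' +
        gaussAvg u v (fun a => Real.sqrt (α a + δ a * t)) (replicaGen Γ (F t))) t := by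
  classical
  have hg : replicaGen Γ (F t) = fun σs => ∑ τs : Fin n → C,
      F t τs * replicaGen Γ (fun ρs => if ρs = τs then (1 : ℝ) else 0) σs := by
    funext σs
    simp [replicaGen]
  rw [hg, gaussAvg_sum, gaussAvg_eq_sum u v _ F', ← Finset.sum_add_distrib]
  simp_rw [gaussAvg_eq_sum u v _ (F _), gaussAvg_const_mul]
  refine HasDerivAt.fun_sum fun σs _ => (hF σs).mul ?_
  simp_rw [gaussWeight_eq_gaussAvg]
  exact hasDerivAt_gaussAvg_sqrt u v h hΓ _

lemma gaussAvg_exp_mul_le (u : C → ℝ) (v : A → C → ℝ) (c : A → ℝ) (Y : C → C → ℝ)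
    {r : ℝ} (hr : 0 ≤ r) :
    gaussAvg u v c (fun σs : Fin 4 → C => Real.exp (r * Y (σs 2) (σs 3)) * Y (σs 1) (σs 0)) ≤
      gaussAvg u v c (fun σs : Fin 2 → C => Real.exp (r * Y (σs 0) (σs 1)) * Y (σs 0) (σs 1)) := by
  set f : (Fin 2 → C) → ℝ := fun σs => Real.exp (r * Y (σs 0) (σs 1)) * Y (σs 0) (σs 1) with hf
  set g : (Fin 4 → C) → ℝ := fun σs => Real.exp (r * Y (σs 2) (σs 3)) * Y (σs 1) (σs 0) with hg
  have h1 : gaussAvg u v c (fun σs : Fin 4 → C => f fun j => σs ((![2, 3] : Fin 2 → Fin 4) j)) =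
      gaussAvg u v c f := gaussAvg_comp_injective u v c f (by decide)
  have h2 : gaussAvg u v c (fun σs : Fin 4 → C => f fun j => σs ((![1, 0] : Fin 2 → Fin 4) j)) =
      gaussAvg u v c f := gaussAvg_comp_injective u v c f (by decide)
  have h3 : gaussAvg u v c
      (fun σs : Fin 4 → C => g fun j => σs ((![3, 2, 1, 0] : Fin 4 → Fin 4) j)) =
      gaussAvg u v c g := gaussAvg_comp_injective u v c g (by decide)
  have h4 : gaussAvg u v c
      (fun σs : Fin 4 → C => g fun j => σs ((![3, 2, 1, 0] : Fin 4 → Fin 4) j)) =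
      gaussAvg u v c
      (fun σs : Fin 4 → C => Real.exp (r * Y (σs 1) (σs 0)) * Y (σs 2) (σs 3)) := rfl
  have h5 := gaussAvg_mono u v c (f := fun σs : Fin 4 → C =>
      g σs + Real.exp (r * Y (σs 1) (σs 0)) * Y (σs 2) (σs 3))
    (g := fun σs : Fin 4 → C => (f fun j => σs ((![2, 3] : Fin 2 → Fin 4) j)) +
      (f fun j => σs ((![1, 0] : Fin 2 → Fin 4) j))) (fun σs => by
    simp only [hf, hg, Matrix.cons_val_zero, Matrix.cons_val_one]
    set a := Y (σs 2) (σs 3)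
    set b := Y (σs 1) (σs 0)
    rcases le_total a b with hab | hab
    · have : Real.exp (r * a) ≤ Real.exp (r * b) := Real.exp_le_exp.2 (by gcongr)
      nlinarith
    · have : Real.exp (r * b) ≤ Real.exp (r * a) := Real.exp_le_exp.2 (by gcongr)
      nlinarith)
  rw [gaussAvg_add, gaussAvg_add, h1, h2, ← h4, h3] at h5
  linarith

/-- If the covariance slope is `b Y` up to a constant, with `Y` nonnegative and constant on the
diagonal, the exponential moment of `Y` at the end point of the path is controlled by the one at
the origin, with a slightly larger exponent. -/
lemma gaussAvg_exp_le {α δ : A → ℝ} (u : C → ℝ) (v : A → C → ℝ)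
    (hpos : ∀ t ∈ Set.Ioo (0 : ℝ) 1, ∀ a, δ a = 0 ∨ 0 < α a + δ a * t) {Y : C → C → ℝ} {b d e : ℝ}
    (hb : 0 ≤ b) (hcov : ∀ σ τ, ∑ a, δ a / 2 * (v a σ * v a τ) = b * Y σ τ + e)
    (hY : ∀ σ τ, 0 ≤ Y σ τ) (hsymm : ∀ σ τ, Y σ τ = Y τ σ) (hd : ∀ σ, Y σ σ = d)
    {r : ℝ} (hr : 8 * b ≤ r) :
    gaussAvg u v (fun a => Real.sqrt (α a + δ a * 1))
        (fun σs : Fin 2 → C => Real.exp ((r - 8 * b) * Y (σs 0) (σs 1))) ≤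
      gaussAvg u v (fun a => Real.sqrt (α a + δ a * 0))
        (fun σs : Fin 2 → C => Real.exp (r * Y (σs 0) (σs 1))) := by
  set F : ℝ → (Fin 2 → C) → ℝ := fun t σs => Real.exp ((r - 8 * b * t) * Y (σs 0) (σs 1)) with hF
  set φ : ℝ → ℝ := fun t => gaussAvg u v (fun a => Real.sqrt (α a + δ a * t)) (F t) with hφ
  suffices hanti : AntitoneOn φ (Set.Icc 0 1) by
    have := hanti (Set.left_mem_Icc.2 zero_le_one) (Set.right_mem_Icc.2 zero_le_one) zero_le_one
    simpa [hφ, hF] using this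
  have hFd : ∀ t σs, HasDerivAt (fun s => F s σs)
      (-(8 * b) * (F t σs * Y (σs 0) (σs 1))) t := by
    intro t σs
    have h := ((((hasDerivAt_id t).const_mul (8 * b)).const_sub r).mul_const
      (Y (σs 0) (σs 1))).exp
    refine h.congr_deriv ?_
    simp only [hF, id_eq]
    ring
  refine antitoneOn_of_hasDerivWithinAt_nonpos (convex_Icc 0 1)
    (f' := fun t => gaussAvg u v (fun a => Real.sqrt (α a + δ a * t))
        (fun σs => -(8 * b) * (F t σs * Y (σs 0) (σs 1))) +
      gaussAvg u v (fun a => Real.sqrt (α a + δ a * t))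
        (replicaGen (fun σ τ => b * Y σ τ) (F t))) ?_ ?_ ?_
  · refine Continuous.continuousOn ?_
    have : φ = fun t => ∑ σs : Fin 2 → C, F t σs *
        gaussWeight u v (fun a => Real.sqrt (α a + δ a * t)) σs :=
      funext fun t => gaussAvg_eq_sum _ _ _ _
    rw [this]
    classical
    refine continuous_finsetSum _ fun σs _ => Continuous.mul ?_ ?_
    · exact continuous_iff_continuousAt.2 fun t => (hFd t σs).continuousAt
    · simp_rw [gaussWeight_eq_gaussAvg]
      exact continuous_gaussAvg _ _ (fun a => by fun_prop) _
  · intro t ht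
    rw [interior_Icc] at ht
    have h := hasDerivAt_gaussAvg_sqrt_family u v (hpos t ht) hcov (hFd t)
    rw [replicaGen_add_const] at h
    exact h.hasDerivWithinAt
  · intro t ht
    rw [interior_Icc] at ht
    set c : A → ℝ := fun a => Real.sqrt (α a + δ a * t)
    have hr' : 0 ≤ r - 8 * b * t := by nlinarith [ht.1, ht.2]
    have h1 : gaussAvg u v c (replicaGen (fun σ τ => b * Y σ τ) (F t)) ≤
        gaussAvg u v c (fun σs : Fin 4 → C =>
          2 * b * (F t ![σs 2, σs 3] * Y (σs 2) (σs 3)) +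
          6 * b * (Real.exp ((r - 8 * b * t) * Y (σs 2) (σs 3)) * Y (σs 1) (σs 0))) := by
      refine gaussAvg_mono _ _ _ fun σs => ?_
      refine (replicaGen_two_le (Y := fun σ τ => b * Y σ τ) (d := b * d)
        (fun σ τ => mul_nonneg hb (hY σ τ)) (fun σ τ => by rw [hsymm]) (fun σ => by rw [hd])
        (fun σs => (Real.exp_pos _).le) σs).trans (le_of_eq ?_)
      simp only [hF, Matrix.cons_val_zero, Matrix.cons_val_one]
      ring
    rw [gaussAvg_add, gaussAvg_const_mul, gaussAvg_const_mul] at h1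
    have h2 : gaussAvg u v c (fun σs : Fin 4 → C => F t ![σs 2, σs 3] * Y (σs 2) (σs 3)) =
        gaussAvg u v c (fun σs : Fin 2 → C => F t σs * Y (σs 0) (σs 1)) :=
      gaussAvg_comp_injective u v c (fun σs : Fin 2 → C => F t σs * Y (σs 0) (σs 1))
        (e := (![2, 3] : Fin 2 → Fin 4)) (by decide)
    have h3 := gaussAvg_exp_mul_le u v c Y hr'
    have h4 : gaussAvg u v c (fun σs : Fin 2 → C =>
        Real.exp ((r - 8 * b * t) * Y (σs 0) (σs 1)) * Y (σs 0) (σs 1)) =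
        gaussAvg u v c (fun σs : Fin 2 → C => F t σs * Y (σs 0) (σs 1)) := rfl
    rw [h2] at h1
    rw [h4] at h3
    rw [gaussAvg_const_mul]
    nlinarith

end expMoment

/-! ### The decoupled model -/

lemma exp_le_add_exp_sq (x : ℝ) : Real.exp x ≤ x + Real.exp (x ^ 2) := by
  rcases le_total |x| 1 with h | h
  · have h1 := (abs_le.1 (Real.abs_exp_sub_one_sub_id_le h)).2
    have h2 := Real.add_one_le_exp (x ^ 2)
    linarith
  · rcases le_abs'.1 h with h | h
    · have h1 := Real.add_one_le_exp (x ^ 2)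
      have h2 : Real.exp x ≤ 1 := Real.exp_le_one_iff.2 (by linarith)
      nlinarith
    · have h1 : Real.exp x ≤ Real.exp (x ^ 2) := Real.exp_le_exp.2 (by nlinarith)
      linarith

lemma centered_exp_le {q : ℝ} (hq : 0 ≤ q) (hq1 : q ≤ 1) (s : ℝ) :
    (1 + q) / 2 * Real.exp (s * (1 - q)) + (1 - q) / 2 * Real.exp (s * (-1 - q)) ≤
      Real.exp (4 * s ^ 2) := by
  have h1 := exp_le_add_exp_sq (s * (1 - q))
  have h2 := exp_le_add_exp_sq (s * (-1 - q))
  have h3 : Real.exp ((s * (1 - q)) ^ 2) ≤ Real.exp (4 * s ^ 2) :=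
    Real.exp_le_exp.2 (by rw [mul_pow]; nlinarith [sq_nonneg s])
  have h4 : Real.exp ((s * (-1 - q)) ^ 2) ≤ Real.exp (4 * s ^ 2) :=
    Real.exp_le_exp.2 (by rw [mul_pow]; nlinarith [sq_nonneg s])
  have h5 : (1 + q) / 2 * Real.exp (s * (1 - q)) ≤
      (1 + q) / 2 * (s * (1 - q) + Real.exp (4 * s ^ 2)) :=
    mul_le_mul_of_nonneg_left (by linarith) (by linarith)
  have h6 : (1 - q) / 2 * Real.exp (s * (-1 - q)) ≤
      (1 - q) / 2 * (s * (-1 - q) + Real.exp (4 * s ^ 2)) :=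
    mul_le_mul_of_nonneg_left (by linarith) (by linarith)
  linarith

lemma gibbsProb_sum_sites {N : ℕ} (θ : Fin N → ℝ) (σ : Cfg N) :
    gibbsProb (fun τ : Cfg N => ∑ i, θ i * spin (τ i)) σ =
      ∏ i, (1 + spin (σ i) * Real.tanh (θ i)) / 2 := by
  unfold gibbsProb
  simp_rw [Real.exp_sum]
  rw [sum_prod_mul_eq (fun i b => Real.exp (θ i * spin b)), ← Finset.prod_div_distrib]
  refine Finset.prod_congr rfl fun i _ => ?_
  have hp : 0 < Real.exp (θ i) + Real.exp (-θ i) := by positivity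
  rw [Fintype.sum_bool, Real.tanh_eq]
  cases σ i <;> simp [spin] <;> field_simp <;> ring

lemma replicaAvg_prod_sites {N : ℕ} (θ : Fin N → ℝ) (s q : ℝ) :
    replicaAvg (fun τ : Cfg N => ∑ i, θ i * spin (τ i))
        (fun σs : Fin 2 → Cfg N => Real.exp (s * ∑ i, (spin (σs 0 i) * spin (σs 1 i) - q))) =
      ∏ i, ((1 + Real.tanh (θ i) ^ 2) / 2 * Real.exp (s * (1 - q)) +
        (1 - Real.tanh (θ i) ^ 2) / 2 * Real.exp (s * (-1 - q))) := by
  unfold replicaAvg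
  simp_rw [gibbsProb_sum_sites, Fin.prod_univ_two, ← Finset.prod_mul_distrib, Finset.mul_sum,
    Real.exp_sum, ← Finset.prod_mul_distrib]
  rw [← (Equiv.piComm fun (_ : Fin N) (_ : Fin 2) => Bool).sum_comp]
  simp only [Equiv.piComm_apply]
  rw [sum_prod_mul_eq fun (i : Fin N) (b : Fin 2 → Bool) =>
    Real.exp (s * (spin (b 0) * spin (b 1) - q)) *
      ((1 + spin (b 0) * Real.tanh (θ i)) / 2 * ((1 + spin (b 1) * Real.tanh (θ i)) / 2))]
  refine Finset.prod_congr rfl fun i _ => ?_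
  rw [← (finTwoArrowEquiv Bool).symm.sum_comp, Fintype.sum_prod_type]
  simp [spin]
  ring

lemma integrable_tanh_sq (a b : ℝ) :
    Integrable (fun z : ℝ => Real.tanh (a + b * z) ^ 2) (gaussianReal 0 1) := by
  have hc : Continuous Real.tanh := by
    rw [show Real.tanh = fun x => Real.sinh x / Real.cosh x from
      funext fun x => Real.tanh_eq_sinh_div_cosh x]
    exact Real.continuous_sinh.div Real.continuous_cosh fun x => (Real.cosh_pos x).ne'
  refine Integrable.of_bound (C := 1) (Continuous.aestronglyMeasurable (by fun_prop))
    (Filter.Eventually.of_forall fun z => ?_)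
  rw [Real.norm_eq_abs, abs_pow, sq_le_one_iff_abs_le_one, abs_abs]
  exact (Real.abs_tanh_lt_one _).le

lemma gaussAvg_decoupled_le (M : ℕ) {β h q : ℝ} (hq : 0 ≤ q) (hq1 : q ≤ 1)
    (hfix : q = ∫ z, Real.tanh (β * z * Real.sqrt q + h) ^ 2 ∂ (gaussianReal 0 1 : Measure ℝ))
    (s : ℝ) :
    gaussAvg (skExt M h) (skField M β q)
        (fun a => Real.sqrt (decoupledBase M a + decoupledSlope M a * 0))
        (fun σs : Fin 2 → Cfg (M + 1) =>
          Real.exp (s * ∑ i, (spin (σs 0 i) * spin (σs 1 i) - q))) ≤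
      Real.exp (4 * s ^ 2) ^ (M + 1) := by
  have hH : ∀ x : SKIdx M → ℝ, linHam (skExt M h) (skField M β q)
      (fun a => Real.sqrt (decoupledBase M a + decoupledSlope M a * 0)) x =
      fun τ => ∑ i, (h + β * Real.sqrt q * x (Sum.inr i)) * spin (τ i) := by
    intro x
    funext τ
    unfold linHam skExt
    rw [Fintype.sum_sum_type]
    simp only [decoupledBase, skField, Sum.elim_inl, Sum.elim_inr, mul_zero, add_zero,
      Real.sqrt_zero, zero_mul, Finset.sum_const_zero, zero_add, Real.sqrt_one, one_mul,
      Finset.mul_sum, ← Finset.sum_add_distrib]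
    exact Finset.sum_congr rfl fun i _ => by ring
  set G : ℝ → ℝ := fun y =>
    (1 + Real.tanh (h + β * Real.sqrt q * y) ^ 2) / 2 * Real.exp (s * (1 - q)) +
      (1 - Real.tanh (h + β * Real.sqrt q * y) ^ 2) / 2 * Real.exp (s * (-1 - q)) with hG
  have hI := integrable_tanh_sq h (β * Real.sqrt q)
  have hfix' : ∫ z, Real.tanh (h + β * Real.sqrt q * z) ^ 2 ∂(gaussianReal 0 1) = q := by
    conv_rhs => rw [hfix]
    refine integral_congr_ae (Filter.Eventually.of_forall fun z => ?_)
    simp only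
    congr 2
    ring
  have hGint : ∫ y, G y ∂(gaussianReal 0 1) =
      (1 + q) / 2 * Real.exp (s * (1 - q)) + (1 - q) / 2 * Real.exp (s * (-1 - q)) := by
    have hlin : ∀ y, G y = (Real.exp (s * (1 - q)) + Real.exp (s * (-1 - q))) / 2 +
        (Real.exp (s * (1 - q)) - Real.exp (s * (-1 - q))) / 2 *
          Real.tanh (h + β * Real.sqrt q * y) ^ 2 := fun y => by simp only [hG]; ring
    simp_rw [hlin]
    rw [integral_add (integrable_const _) (hI.const_mul _), integral_const_mul, hfix',
      integral_const, probReal_univ, one_smul]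
    ring
  unfold gaussAvg
  simp_rw [hH, replicaAvg_prod_sites]
  have hprod : ∀ x : SKIdx M → ℝ, ∏ i, G (x (Sum.inr i)) =
      ∏ a : SKIdx M, (Sum.elim (fun _ _ => 1) (fun _ => G) a : ℝ → ℝ) (x a) := by
    intro x
    rw [Fintype.prod_sum_type]
    simp
  calc ∫ x, ∏ i, G (x (Sum.inr i)) ∂(gaussPi (SKIdx M))
      = (∫ y, G y ∂(gaussianReal 0 1)) ^ (M + 1) := by
        simp_rw [hprod]
        rw [gaussPi, integral_fintype_prod_eq_prod, Fintype.prod_sum_type]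
        simp
    _ ≤ Real.exp (4 * s ^ 2) ^ (M + 1) := by
        rw [hGint]
        refine pow_le_pow_left₀ ?_ (centered_exp_le hq hq1 s) _
        have : 0 ≤ 1 - q := by linarith
        positivity

lemma integral_exp_mul_gaussianReal (y : ℝ) :
    ∫ g, Real.exp (y * g) ∂(gaussianReal 0 1) = Real.exp (y ^ 2 / 2) := by
  have h := congrFun (mgf_id_gaussianReal (μ := 0) (v := 1)) y
  simpa [mgf] using h

lemma integrable_exp_sq_gaussianReal :
    Integrable (fun g : ℝ => Real.exp (g ^ 2 / 4)) (gaussianReal 0 1) := by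
  rw [gaussianReal_of_var_ne_zero _ one_ne_zero]
  have hpdf : gaussianPDF 0 1 = fun x => ENNReal.ofReal (gaussianPDFReal 0 1 x) := rfl
  rw [hpdf, integrable_withDensity_iff_integrable_smul₀']
  · refine ((integrable_exp_neg_mul_sq (b := 1 / 4) (by norm_num)).const_mul
      (Real.sqrt (2 * Real.pi * ((1 : NNReal) : ℝ)))⁻¹).congr
      (Filter.Eventually.of_forall fun x => ?_)
    simp only [smul_eq_mul]
    rw [ENNReal.toReal_ofReal (gaussianPDFReal_nonneg 0 1 x), gaussianPDFReal,
      mul_assoc _ (Real.exp _) (Real.exp _), ← Real.exp_add]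
    congr 2
    simp only [NNReal.coe_one]
    ring
  · exact (measurable_gaussianPDFReal 0 1).ennreal_ofReal.aemeasurable
  · exact Filter.Eventually.of_forall fun x => ENNReal.ofReal_lt_top

/-- The exponential moment bounding the overlap fluctuations. -/
def expMomentConst : ℝ := ∫ g, Real.exp (g ^ 2 / 4) ∂(gaussianReal 0 1)

lemma expMomentConst_nonneg : 0 ≤ expMomentConst :=
  integral_nonneg fun _ => (Real.exp_pos _).le

lemma gaussAvg_decoupled_exp_sq_le (M : ℕ) {β h q : ℝ} (hq : 0 ≤ q) (hq1 : q ≤ 1)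
    (hfix : q = ∫ z, Real.tanh (β * z * Real.sqrt q + h) ^ 2 ∂ (gaussianReal 0 1 : Measure ℝ)) :
    gaussAvg (skExt M h) (skField M β q)
        (fun a => Real.sqrt (decoupledBase M a + decoupledSlope M a * 0))
        (fun σs : Fin 2 → Cfg (M + 1) =>
          Real.exp (1 / 32 * ((M + 1) * (overlap (M + 1) (σs 0) (σs 1) - q) ^ 2))) ≤
      expMomentConst := by
  have hN : (0 : ℝ) < M + 1 := by positivity
  set k : ℝ := Real.sqrt (1 / (16 * (M + 1))) with hk
  have hk2 : k ^ 2 = 1 / (16 * (M + 1)) := Real.sq_sqrt (by positivity)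
  set S : (Fin 2 → Cfg (M + 1)) → ℝ := fun σs => ∑ i, (spin (σs 0 i) * spin (σs 1 i) - q) with hS
  have hlin : ∀ σs : Fin 2 → Cfg (M + 1),
      Real.exp (1 / 32 * ((M + 1) * (overlap (M + 1) (σs 0) (σs 1) - q) ^ 2)) =
        ∫ g, Real.exp (k * g * S σs) ∂(gaussianReal 0 1) := by
    intro σs
    have h1 := integral_exp_mul_gaussianReal (k * S σs)
    have h2 : ∀ g, k * g * S σs = k * S σs * g := fun g => by ring
    simp_rw [h2, h1, mul_pow, hk2]
    congr 1
    simp only [hS, overlap, Finset.sum_sub_distrib, Finset.sum_const, Finset.card_univ,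
      Fintype.card_fin, nsmul_eq_mul]
    push_cast
    field_simp
    ring
  rw [gaussAvg_eq_sum]
  simp_rw [hlin, ← integral_mul_const]
  have h_exp : ∀ y : ℝ, Integrable (fun g => Real.exp (k * g * y)) (gaussianReal 0 1) := by
    intro y
    have h2 : ∀ g, k * g * y = k * y * g := fun g => by ring
    simp_rw [h2]
    exact integrable_exp_mul_gaussianReal _
  rw [← integral_finsetSum _ fun σs _ => (h_exp (S σs)).mul_const _]
  refine integral_mono (integrable_finsetSum _ fun σs _ => (h_exp (S σs)).mul_const _)
    integrable_exp_sq_gaussianReal fun g => ?_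
  have h := gaussAvg_decoupled_le M hq hq1 hfix (k * g)
  rw [gaussAvg_eq_sum] at h
  refine h.trans (le_of_eq ?_)
  rw [← Real.exp_nat_mul, mul_pow, hk2]
  congr 1
  push_cast
  field_simp
  ring

lemma overlap_comm (N : ℕ) (σ τ : Cfg N) : overlap N σ τ = overlap N τ σ := by
  unfold overlap
  simp_rw [mul_comm]

lemma overlap_self (M : ℕ) (σ : Cfg (M + 1)) : overlap (M + 1) σ σ = 1 := by
  unfold overlap
  have : (M : ℝ) + 1 ≠ 0 := by positivity
  simp [spin_mul_self, this]

/-- Exponential control of the overlap at high temperature. -/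
lemma nuT_exp_sq_overlap_le (M : ℕ) {β h q : ℝ} (hβ : 0 ≤ β) (hβ' : β ≤ 1 / 12)
    (hq : 0 ≤ q) (hq1 : q ≤ 1)
    (hfix : q = ∫ z, Real.tanh (β * z * Real.sqrt q + h) ^ 2 ∂ (gaussianReal 0 1 : Measure ℝ)) :
    nuT M β h q 1 (fun σs : Fin 2 → Cfg (M + 1) =>
        Real.exp (1 / 64 * ((M + 1) * (overlap (M + 1) (σs 0) (σs 1) - q) ^ 2))) ≤
      expMomentConst := by
  have hβ2 : β ^ 2 ≤ 1 / 144 := by nlinarith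
  have h1 := gaussAvg_exp_le (α := decoupledBase M) (δ := decoupledSlope M) (r := 1 / 32)
    (skExt M h) (skField M β q)
    (fun t ht a => by
      right
      rcases a with p | i
      · simpa [decoupledBase, decoupledSlope] using ht.1
      · simpa [decoupledBase, decoupledSlope] using ht.2)
    (Y := fun σ τ => (M + 1) * (overlap (M + 1) σ τ - q) ^ 2) (b := β ^ 2 / 4)
    (by positivity) (decoupled_covariance M hq) (fun σ τ => by positivity)
    (fun σ τ => by rw [overlap_comm]) (fun σ => by rw [overlap_self]) (by linarith)
  refine le_trans ?_ (h1.trans (gaussAvg_decoupled_exp_sq_le M hq hq1 hfix))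
  have hc : (fun a => Real.sqrt (cavityBase M a + cavitySlope M a * 1)) =
      fun a => Real.sqrt (decoupledBase M a + decoupledSlope M a * 1) := by
    funext a
    congr 1
    rcases a with p | i
    · by_cases hp : p.2 = Fin.last M <;>
        simp [cavityBase, cavitySlope, decoupledBase, decoupledSlope, hp]
    · by_cases hi : i = Fin.last M <;>
        simp [cavityBase, cavitySlope, decoupledBase, decoupledSlope, hi]
  rw [nuT_eq_gaussAvg, hc]
  refine gaussAvg_mono _ _ _ fun σs => Real.exp_le_exp.2 ?_
  exact mul_le_mul_of_nonneg_right (by linarith) (by positivity)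

/-! ### Moments of the overlap -/

/-- A bound for the normalized moments of the truncated overlap. -/
def overlapMomentConst (k : ℕ) : ℝ := 4 ^ k * (64 ^ k * k.factorial + 1) * expMomentConst

lemma overlapMomentConst_nonneg (k : ℕ) : 0 ≤ overlapMomentConst k :=
  mul_nonneg (by positivity) expMomentConst_nonneg

lemma abs_overlapMinus_sub_overlap_le (M : ℕ) (σ τ : Cfg (M + 1)) :
    |overlapMinus M σ τ - overlap (M + 1) σ τ| ≤ 1 / (M + 1) := by
  have hN : (0 : ℝ) < M + 1 := by positivity
  unfold overlapMinus overlap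
  rw [Fin.sum_univ_castSucc]
  push_cast
  rw [← sub_div, sub_add_cancel_left, abs_div, abs_neg, abs_mul, abs_spin, abs_spin, one_mul,
    abs_of_pos hN]

lemma overlapMinus_pow_le (M k : ℕ) (q : ℝ) (σ τ : Cfg (M + 1)) :
    (overlapMinus M σ τ - q) ^ (2 * k) ≤ 4 ^ k * (64 ^ k * k.factorial + 1) / (M + 1) ^ k *
      Real.exp (1 / 64 * ((M + 1) * (overlap (M + 1) σ τ - q) ^ 2)) := by
  have hN : (0 : ℝ) < M + 1 := by positivity
  set x := overlap (M + 1) σ τ - q with hx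
  set E := Real.exp (1 / 64 * ((M + 1) * x ^ 2)) with hE
  have hE1 : 1 ≤ E := Real.one_le_exp (by positivity)
  have h1 : |overlapMinus M σ τ - q| ≤ |x| + 1 / (M + 1) := by
    have := abs_overlapMinus_sub_overlap_le M σ τ
    calc |overlapMinus M σ τ - q|
        = |x + (overlapMinus M σ τ - overlap (M + 1) σ τ)| := by congr 1; rw [hx]; ring
      _ ≤ _ := (abs_add_le _ _).trans (by linarith)
  have h2 : (overlapMinus M σ τ - q) ^ (2 * k) ≤
      4 ^ k * (x ^ (2 * k) + (1 / (M + 1)) ^ (2 * k)) := by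
    rw [← Even.pow_abs (even_two_mul k), ← Even.pow_abs (even_two_mul k) x]
    refine (pow_le_pow_left₀ (abs_nonneg _) h1 _).trans ?_
    refine (add_pow_le (abs_nonneg _) (by positivity) _).trans ?_
    refine mul_le_mul_of_nonneg_right ?_ (by positivity)
    rw [show (4 : ℝ) = 2 ^ 2 by norm_num, ← pow_mul]
    exact pow_le_pow_right₀ one_le_two (Nat.sub_le _ _)
  have h3 : x ^ (2 * k) ≤ 64 ^ k * k.factorial / (M + 1) ^ k * E := by
    have h := Real.pow_div_factorial_le_exp (x := 1 / 64 * ((M + 1) * x ^ 2)) (by positivity) k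
    rw [div_le_iff₀ (by positivity), mul_pow, mul_pow, ← pow_mul] at h
    rw [div_mul_eq_mul_div, le_div_iff₀ (by positivity)]
    calc x ^ (2 * k) * (M + 1) ^ k
        = 64 ^ k * ((1 / 64) ^ k * ((M + 1) ^ k * x ^ (2 * k))) := by
          rw [← mul_assoc, ← mul_pow, mul_one_div_cancel (by norm_num), one_pow]
          ring
      _ ≤ 64 ^ k * (E * k.factorial) := mul_le_mul_of_nonneg_left h (by positivity)
      _ = _ := by ring
  have h4 : (1 / ((M : ℝ) + 1)) ^ (2 * k) ≤ 1 / (M + 1) ^ k * E := by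
    calc (1 / ((M : ℝ) + 1)) ^ (2 * k) ≤ (1 / ((M : ℝ) + 1)) ^ k := by
          refine pow_le_pow_of_le_one (by positivity) ?_ (by omega)
          rw [div_le_one hN]
          have : (0 : ℝ) ≤ M := by positivity
          linarith
      _ = 1 / (M + 1) ^ k := by rw [div_pow, one_pow]
      _ ≤ _ := le_mul_of_one_le_right (by positivity) hE1
  calc _ ≤ 4 ^ k * (x ^ (2 * k) + (1 / (M + 1)) ^ (2 * k)) := h2
    _ ≤ 4 ^ k * (64 ^ k * k.factorial / (M + 1) ^ k * E + 1 / (M + 1) ^ k * E) := by gcongr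
    _ = _ := by ring

lemma nuT_overlapMinus_pow_le (M k : ℕ) {β h q : ℝ} (hβ : 0 ≤ β) (hβ' : β ≤ 1 / 12)
    (hq : 0 ≤ q) (hq1 : q ≤ 1)
    (hfix : q = ∫ z, Real.tanh (β * z * Real.sqrt q + h) ^ 2 ∂ (gaussianReal 0 1 : Measure ℝ)) :
    nuT M β h q 1 (fun σs : Fin 2 → Cfg (M + 1) =>
        (overlapMinus M (σs 0) (σs 1) - q) ^ (2 * k)) ≤
      overlapMomentConst k / (M + 1) ^ k := by
  have h1 := nuT_exp_sq_overlap_le M hβ hβ' hq hq1 hfix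
  rw [nuT_eq_gaussAvg] at h1 ⊢
  refine (gaussAvg_mono _ _ _ fun σs => overlapMinus_pow_le M k q (σs 0) (σs 1)).trans ?_
  rw [gaussAvg_const_mul]
  refine (mul_le_mul_of_nonneg_left h1 (by positivity)).trans (le_of_eq ?_)
  rw [overlapMomentConst]
  ring

lemma pairDev_pow_le {C : Type*} {n : ℕ} (hn : 0 < n) (D : C → C → ℝ) (σs : Fin n → C) {k : ℕ}
    (hk : 0 < k) :
    pairDev D σs ^ (2 * k) ≤ ((n : ℝ) ^ 2) ^ (2 * k) *
      ∑ p : Fin n × Fin n, if p.1 = p.2 then 0 else D (σs p.1) (σs p.2) ^ (2 * k) := by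
  obtain ⟨m, hm⟩ : ∃ m, 2 * k = m + 1 := ⟨2 * k - 1, by omega⟩
  have h := pow_sum_div_card_le_sum_pow (s := (Finset.univ : Finset (Fin n × Fin n)))
    (f := fun p => if p.1 = p.2 then 0 else |D (σs p.1) (σs p.2)|)
    (fun p _ => by split_ifs <;> positivity) m
  have hn1 : (1 : ℝ) ≤ n := by exact_mod_cast hn
  have hcard : ((#(Finset.univ : Finset (Fin n × Fin n)) : ℕ) : ℝ) = (n : ℝ) ^ 2 := by
    simp [pow_two]
  rw [hcard, div_le_iff₀ (by positivity), ← hm] at h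
  have hsum : ∑ p : Fin n × Fin n,
      (if p.1 = p.2 then 0 else |D (σs p.1) (σs p.2)|) ^ (2 * k) =
      ∑ p : Fin n × Fin n, if p.1 = p.2 then 0 else D (σs p.1) (σs p.2) ^ (2 * k) := by
    refine Finset.sum_congr rfl fun p _ => ?_
    split_ifs
    · rw [hm, zero_pow m.succ_ne_zero]
    · exact Even.pow_abs (even_two_mul k) _
  rw [hsum, Fintype.sum_prod_type] at h
  refine h.trans ((mul_comm _ _).trans_le (mul_le_mul_of_nonneg_right ?_ ?_))
  · exact pow_le_pow_right₀ (one_le_pow₀ hn1) (by omega)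
  · refine Finset.sum_nonneg fun p _ => ?_
    split_ifs
    · exact le_rfl
    · exact (even_two_mul k).pow_nonneg _

lemma nuT_pairDev_pow_le (M : ℕ) {β h q : ℝ} (hβ : 0 ≤ β) (hβ' : β ≤ 1 / 12)
    (hq : 0 ≤ q) (hq1 : q ≤ 1)
    (hfix : q = ∫ z, Real.tanh (β * z * Real.sqrt q + h) ^ 2 ∂ (gaussianReal 0 1 : Measure ℝ))
    {n k : ℕ} (hn : 0 < n) (hk : 0 < k) :
    nuT M β h q 1 (fun σs : Fin n → Cfg (M + 1) =>
        pairDev (fun σ τ => overlapMinus M σ τ - q) σs ^ (2 * k)) ≤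
      ((n : ℝ) ^ 2) ^ (2 * k + 1) * (overlapMomentConst k / (M + 1) ^ k) := by
  have h1 := nuT_overlapMinus_pow_le M k hβ hβ' hq hq1 hfix
  rw [nuT_eq_gaussAvg] at h1 ⊢
  refine (gaussAvg_mono _ _ _ fun σs => pairDev_pow_le hn _ σs hk).trans ?_
  rw [gaussAvg_const_mul, pow_succ ((n : ℝ) ^ 2), mul_assoc]
  refine mul_le_mul_of_nonneg_left ?_ (by positivity)
  rw [gaussAvg_sum]
  calc _ ≤ ∑ _p : Fin n × Fin n, overlapMomentConst k / ((M : ℝ) + 1) ^ k := by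
        refine Finset.sum_le_sum fun p _ => ?_
        by_cases hp : p.1 = p.2
        · simp only [hp, if_true]
          rw [gaussAvg_eq_sum]
          simp only [zero_mul, Finset.sum_const_zero]
          exact div_nonneg (overlapMomentConst_nonneg k) (by positivity)
        · simp only [hp, if_false]
          refine le_trans (le_of_eq ?_) h1
          refine gaussAvg_comp_injective _ _ _ (fun σs : Fin 2 → Cfg (M + 1) =>
            (overlapMinus M (σs 0) (σs 1) - q) ^ (2 * k)) (e := ![p.1, p.2]) ?_
          have hp' : ¬ p.2 = p.1 := fun h => hp h.symm
          rw [Function.Injective, Fin.forall_fin_two]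
          constructor <;> rw [Fin.forall_fin_two] <;> simp [hp, hp']
    _ = _ := by simp [pow_two]

/-! ### Iterated derivatives along the one-coordinate path -/

/-- Iterates of the generator. -/
def replicaGenIter {C : Type*} {n : ℕ} (Γ : C → C → ℝ) (f : (Fin n → C) → ℝ) :
    (k : ℕ) → (Fin (n + 2 * k) → C) → ℝ
  | 0 => f
  | k + 1 => replicaGen Γ (replicaGenIter Γ f k)

lemma exists_abs_replicaGenIter_le {C : Type*} {n : ℕ} {Γ D : C → C → ℝ} {d : ℝ}
    (hd : ∀ σ, Γ σ σ = d) (hΓ : ∀ σ τ, |Γ σ τ| ≤ |D σ τ|) (k : ℕ) :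
    ∃ e : Fin n → Fin (n + 2 * k), Function.Injective e ∧ ∀ (f : (Fin n → C) → ℝ) σs,
      |replicaGenIter Γ f k σs| ≤
        |f fun l => σs (e l)| * (((n : ℝ) + 2 * k) ^ 2 * pairDev D σs) ^ k := by
  induction k with
  | zero => exact ⟨id, Function.injective_id, fun f σs => by simp [replicaGenIter]⟩
  | succ k ih =>
    obtain ⟨e, he, hb⟩ := ih
    refine ⟨fun l => (e l).succ.succ, fun i j hij => he (by simpa using hij), fun f σs => ?_⟩
    refine (abs_replicaGen_le hd hΓ (replicaGenIter Γ f k) σs).trans ?_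
    have h1 : pairDev D (fun l : Fin (n + 2 * k) => σs l.succ.succ) ≤ pairDev D σs :=
      (pairDev_comp_succ_le D fun l => σs l.succ).trans (pairDev_comp_succ_le D σs)
    have h0 : 0 ≤ pairDev D fun l : Fin (n + 2 * k) => σs l.succ.succ := pairDev_nonneg D _
    have h0' : 0 ≤ pairDev D σs := pairDev_nonneg D _
    have hle : (n : ℝ) + 2 * k ≤ n + 2 * (k + 1 : ℕ) := by push_cast; linarith
    refine (mul_le_mul (b := |f fun l => σs (e l).succ.succ| *
      (((n : ℝ) + 2 * (k + 1 : ℕ)) ^ 2 * pairDev D σs) ^ k)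
      (d := ((n : ℝ) + 2 * (k + 1 : ℕ)) ^ 2 * pairDev D σs) ((hb f _).trans ?_)
      (le_of_eq (by push_cast; ring)) (by positivity) (by positivity)).trans
      (le_of_eq (by rw [pow_succ (_ * pairDev D σs) k, mul_assoc]))
    gcongr

lemma iteratedDerivWithin_nuT (M : ℕ) (β h : ℝ) {q : ℝ} (hq : 0 ≤ q) {n : ℕ}
    (f : (Fin n → Cfg (M + 1)) → ℝ) (k : ℕ) {t : ℝ} (ht : t ∈ Set.Icc (0 : ℝ) 1) :
    iteratedDerivWithin k (fun u => nuT M β h q u f) (Set.Icc 0 1) t =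
      nuT M β h q t (replicaGenIter (cavityKernel M β q) f k) := by
  induction k generalizing t with
  | zero => rw [iteratedDerivWithin_zero]; rfl
  | succ k ih =>
    rw [iteratedDerivWithin_succ, derivWithin_congr (fun s hs => ih hs) (ih ht)]
    exact (hasDerivWithinAt_nuT M β h hq ht _).derivWithin
      (uniqueDiffOn_Icc zero_lt_one t ht)

lemma contDiffOn_nuT (M : ℕ) (β h : ℝ) {q : ℝ} (hq : 0 ≤ q) {n : ℕ}
    (f : (Fin n → Cfg (M + 1)) → ℝ) (k : ℕ) :
    ContDiffOn ℝ k (fun u => nuT M β h q u f) (Set.Icc 0 1) := by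
  refine contDiffOn_of_differentiableOn_deriv (n := (k : ℕ∞)) fun j _ t ht => ?_
  exact ((hasDerivWithinAt_nuT M β h hq ht (replicaGenIter (cavityKernel M β q) f j)).congr
    (fun s hs => iteratedDerivWithin_nuT M β h hq f j hs)
    (iteratedDerivWithin_nuT M β h hq f j ht)).differentiableWithinAt

/-- A bound for the normalized `k`-th derivative along the one-coordinate path. -/
def cavityDerivConst (n k : ℕ) : ℝ :=
  Real.exp (2 * ((n : ℝ) + 2) ^ 4) *
    ((((n : ℝ) + 2 * k) ^ 2) ^ (2 * k) *
      (Real.exp (2 * (((n + 2 * k : ℕ) : ℝ) + 2) ^ 4) *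
        (((n + 2 * k : ℕ) : ℝ) ^ 2) ^ (2 * k + 1) * overlapMomentConst k))

lemma abs_nuT_replicaGenIter_le (M : ℕ) {β h q : ℝ} (hβ : 0 ≤ β) (hβ' : β ≤ 1 / 12)
    (hq : 0 ≤ q) (hq1 : q ≤ 1)
    (hfix : q = ∫ z, Real.tanh (β * z * Real.sqrt q + h) ^ 2 ∂ (gaussianReal 0 1 : Measure ℝ))
    {n k : ℕ} (hk : 0 < k) (f : (Fin n → Cfg (M + 1)) → ℝ) {t : ℝ} (ht : t ∈ Set.Icc (0 : ℝ) 1) :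
    |nuT M β h q t (replicaGenIter (cavityKernel M β q) f k)| ≤
      Real.sqrt (cavityDerivConst n k / (M + 1) ^ k) *
        Real.sqrt (nuT M β h q 1 fun σs => f σs ^ 2) := by
  have hβ2 : β ^ 2 ≤ 2 := by nlinarith
  set D : Cfg (M + 1) → Cfg (M + 1) → ℝ := fun σ τ => overlapMinus M σ τ - q with hD
  obtain ⟨e, he, hb⟩ := exists_abs_replicaGenIter_le (n := n) (D := D)
    (cavityKernel_self M β q) (abs_cavityKernel_le M hβ2) k
  have h1 : nuT M β h q t (fun σs => f σs ^ 2) ≤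
      Real.exp (2 * ((n : ℝ) + 2) ^ 4) * nuT M β h q 1 fun σs => f σs ^ 2 :=
    nuT_le_exp_mul_nuT_one M hβ2 hq hq1 ht fun σs => sq_nonneg _
  have h2 := nuT_le_exp_mul_nuT_one M (h := h) hβ2 hq hq1 ht
    (f := fun σs : Fin (n + 2 * k) → Cfg (M + 1) => pairDev D σs ^ (2 * k))
    fun σs => (even_two_mul k).pow_nonneg _
  have h3 := nuT_pairDev_pow_le M (n := n + 2 * k) hβ hβ' hq hq1 hfix (by omega) hk
  have hstep : |nuT M β h q t (replicaGenIter (cavityKernel M β q) f k)| ≤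
      Real.sqrt (nuT M β h q t fun σs => f σs ^ 2) *
        Real.sqrt ((((n : ℝ) + 2 * k) ^ 2) ^ (2 * k) * nuT M β h q t
          (fun σs : Fin (n + 2 * k) → Cfg (M + 1) => pairDev D σs ^ (2 * k))) := by
    simp_rw [nuT_eq_gaussAvg]
    refine (abs_gaussAvg_le _ _ _ _).trans ((gaussAvg_mono _ _ _ (hb f)).trans ?_)
    refine (gaussAvg_mul_le _ _ _ _ _).trans (le_of_eq ?_)
    rw [← gaussAvg_const_mul]
    congr 2
    · simp_rw [sq_abs]
      exact gaussAvg_comp_injective _ _ _ (fun σs => f σs ^ 2) he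
    · congr 1
      funext σs
      rw [← pow_mul, mul_comm k 2, mul_pow]
  refine hstep.trans ?_
  have hC := overlapMomentConst_nonneg k
  have hnn : ∀ s (l : ℕ) (g : (Fin l → Cfg (M + 1)) → ℝ), (∀ σs, 0 ≤ g σs) →
      0 ≤ nuT M β h q s g := fun s l g hg => by
    rw [nuT_eq_gaussAvg]
    exact gaussAvg_nonneg _ _ _ hg
  have h4 := hnn t n (fun σs => f σs ^ 2) fun σs => sq_nonneg _
  have h5 := hnn t (n + 2 * k) (fun σs => pairDev D σs ^ (2 * k))
    fun σs => (even_two_mul k).pow_nonneg _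
  have h6 := hnn 1 n (fun σs => f σs ^ 2) fun σs => sq_nonneg _
  have h7 := h2.trans (mul_le_mul_of_nonneg_left h3 (Real.exp_pos _).le)
  rw [← Real.sqrt_mul h4, ← Real.sqrt_mul' _ h6]
  refine Real.sqrt_le_sqrt ?_
  refine (mul_le_mul h1 (mul_le_mul_of_nonneg_left h7 (by positivity)) (by positivity)
    (by positivity)).trans (le_of_eq ?_)
  rw [cavityDerivConst]
  ring

/-- Lemma 3, Taylor expansion along the one-coordinate smart path:
`|ν(f) − Σ_{j≤m} ν₀^{(j)}(f)/j!| ≤ K·N^{-(m+1)/2}·ν(f²)^{1/2}`, where `ν = ν_1`. -/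
theorem stmt6 :
    ∃ β₀ : ℝ, 0 < β₀ ∧
      ∀ n : ℕ, 1 ≤ n → ∀ m : ℕ,
        ∃ K : ℝ, ∀ β : ℝ, 0 < β → β < β₀ → ∀ M : ℕ, ∀ h : ℝ, 0 ≤ h → ∀ q : ℝ,
          0 ≤ q → q < 1 →
          q = ∫ z, Real.tanh (β * z * Real.sqrt q + h) ^ 2 ∂ (gaussianReal 0 1 : Measure ℝ) →
          ∀ f : (Fin n → Cfg (M + 1)) → ℝ,
            |nuT M β h q 1 f -
                ∑ j ∈ Finset.range (m + 1),
                  iteratedDerivWithin j (fun u => nuT M β h q u f) (Set.Icc 0 1) 0 /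
                    (Nat.factorial j)| ≤
              K / ((M + 1 : ℝ) ^ (((m : ℝ) + 1) / 2)) *
                Real.sqrt (nuT M β h q 1 (fun σs => f σs ^ 2)) := by
  refine ⟨1 / 12, by norm_num, fun n _ m => ⟨Real.sqrt (cavityDerivConst n (m + 1)), ?_⟩⟩
  intro β hβ hβ' M h _ q hq hq1 hfix f
  have hN : (0 : ℝ) < M + 1 := by positivity
  have hpow : (M + 1 : ℝ) ^ (((m : ℝ) + 1) / 2) = Real.sqrt ((M + 1 : ℝ) ^ (m + 1)) := by
    rw [Real.sqrt_eq_rpow, ← Real.rpow_natCast, ← Real.rpow_mul hN.le]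
    congr 1
    push_cast
    ring
  have hbound : ∀ t ∈ Set.Icc (0 : ℝ) 1,
      ‖iteratedDerivWithin (m + 1) (fun u => nuT M β h q u f) (Set.Icc 0 1) t‖ ≤
        Real.sqrt (cavityDerivConst n (m + 1) / (M + 1) ^ (m + 1)) *
          Real.sqrt (nuT M β h q 1 fun σs => f σs ^ 2) := by
    intro t ht
    rw [iteratedDerivWithin_nuT M β h hq f (m + 1) ht]
    exact abs_nuT_replicaGenIter_le M hβ.le hβ'.le hq hq1.le hfix m.succ_pos f ht
  have hT := taylor_mean_remainder_bound zero_le_one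
    (by exact_mod_cast contDiffOn_nuT M β h hq f (m + 1))
    (Set.right_mem_Icc.2 zero_le_one) hbound
  have hsum : taylorWithinEval (fun u => nuT M β h q u f) m (Set.Icc 0 1) 0 1 =
      ∑ j ∈ Finset.range (m + 1),
        iteratedDerivWithin j (fun u => nuT M β h q u f) (Set.Icc 0 1) 0 / (Nat.factorial j) := by
    rw [taylor_within_apply]
    refine Finset.sum_congr rfl fun j _ => ?_
    rw [sub_zero, one_pow, mul_one, smul_eq_mul, inv_mul_eq_div]
  rw [hsum, Real.norm_eq_abs, sub_zero, one_pow, mul_one, Real.sqrt_div' _ (by positivity),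
    ← hpow] at hT
  refine hT.trans (div_le_self (by positivity) ?_)
  exact_mod_cast m.factorial_pos

end
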